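/- arXiv:2505.07190 — 2 statements merged into one kernel-verified Lean document; each statement's English description precedes it below -/
import Mathlib

section
/- Let X be an irreducible Noetherian topological space of dimension ≥ 2 and let Z ⊊ X be a proper closed subset. If the open complement U = X \ Z is affine (as a scheme) and X is proper, then Z has pure codimension 1 in X, i.e., every irreducible component of Z has codimension 1. -/
/-- A finitely generated domain over a field of characteristic zero has finite normalization. -/
theorem finite_integralClosure_of_finiteType (k A K : Type*) [Field k] [CharZero k] [CommRing A]
    [IsDomain A] [Algebra k A] [Algebra.FiniteType k A] [Field K] [Algebra A K]
    [IsFractionRing A K] : Module.Finite A (integralClosure A K) := by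
  obtain ⟨n, g, hg, hfin⟩ := exists_finite_inj_algHom_of_fg k A
  let P := MvPolynomial (Fin n) k
  let _ : Algebra P A := g.toRingHom.toAlgebra
  let _ : Algebra P K := ((algebraMap A K).comp g.toRingHom).toAlgebra
  have : IsScalarTower P A K := .of_algebraMap_eq fun _ ↦ rfl
  have : Module.Finite P A := hfin
  have : FaithfulSMul P A := (faithfulSMul_iff_algebraMap_injective P A).mpr hg
  have : FaithfulSMul P K := (faithfulSMul_iff_algebraMap_injective P K).mpr
    ((IsFractionRing.injective A K).comp hg)
  let F := FractionRing P
  let _ : Algebra F K := FractionRing.liftAlgebra P K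
  have : IsScalarTower P F K := FractionRing.isScalarTower_liftAlgebra P K
  have : IsLocalization (Algebra.algebraMapSubmonoid A (nonZeroDivisors P)) K :=
    inferInstance
  have : FiniteDimensional F K := Module.Finite.of_isLocalization P A (nonZeroDivisors P)
  have : CharZero F := charZero_of_injective_algebraMap (FaithfulSMul.algebraMap_injective k F)
  have : Algebra.IsIntegral P A := inferInstance
  have : IsIntegralClosure (integralClosure A K) P K :=
    { algebraMap_injective := Subtype.val_injective
      isIntegral_iff := fun {x} ↦ ⟨fun h ↦ ⟨⟨x, h.tower_top⟩, rfl⟩, by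
        rintro ⟨y, rfl⟩
        exact isIntegral_trans (R := P) (A := A) _ y.2⟩ }
  have : Module.Finite P (integralClosure A K) := IsIntegralClosure.finite P F K _
  exact Module.Finite.of_restrictScalars_finite P A _

/-- The punctured spectrum of a Noetherian normal local domain of dimension at least two has no
extra regular functions. -/
theorem mem_range_algebraMap_of_forall_prime {S K : Type*} [CommRing S] [IsDomain S]
    [IsLocalRing S] [IsNoetherianRing S] [IsIntegrallyClosed S] [Field K] [Algebra S K]
    [IsFractionRing S K] (hS : 1 < (IsLocalRing.maximalIdeal S).height) (b : K)
    (hb : ∀ P : Ideal S, P.IsPrime → P ≠ IsLocalRing.maximalIdeal S →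
      ∃ s ∉ P, s • b ∈ (1 : Submodule S K)) :
    b ∈ (1 : Submodule S K) := by
  by_contra hb1
  let N : Submodule S K := 1
  obtain ⟨P, hP, hle⟩ := exists_le_isAssociatedPrime_of_isNoetherianRing S (N.mkQ b)
    (by simpa [N] using hb1)
  obtain ⟨hPp, y, hy⟩ := isAssociatedPrime_iff.mp hP
  obtain ⟨c, rfl⟩ := N.mkQ_surjective y
  have key (s : S) (x : K) : s ∈ (⊥ : Submodule S (K ⧸ N)).colon {N.mkQ x} ↔ s • x ∈ N := by
    rw [Submodule.mem_colon_singleton, ← map_smul, Submodule.mem_bot]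
    exact Submodule.Quotient.mk_eq_zero N
  have hPm : P = IsLocalRing.maximalIdeal S := by
    by_contra hne
    obtain ⟨s, hs, hsb⟩ := hb P hPp hne
    exact hs (hle ((key s b).mpr hsb))
  have hmem (s : S) : s ∈ P ↔ s • c ∈ N := by rw [hy, key]
  have hc : c ∉ N := fun h ↦ hPp.ne_top ((Ideal.eq_top_iff_one _).mpr ((hmem 1).mpr (by simpa)))
  have hP0 : P ≠ ⊥ := by
    rintro rfl
    rw [← hPm] at hS
    simp at hS
  obtain ⟨t, htP, ht0⟩ := Submodule.exists_mem_ne_zero_of_ne_bot hP0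
  by_cases hcase : ∀ s ∈ P, ∃ r ∈ P, algebraMap S K r = s • c
  · refine hc ?_
    have hint : IsIntegral S c := by
      refine isIntegral_of_smul_mem_submodule (M := K)
        (N := Submodule.map (Algebra.linearMap S K) P) ?_ ?_ c ?_
      · rw [Submodule.ne_bot_iff]
        exact ⟨_, ⟨t, htP, rfl⟩, by simpa using ht0⟩
      · exact (IsNoetherian.noetherian P).map _
      · rintro _ ⟨s, hs, rfl⟩
        obtain ⟨r, hr, e⟩ := hcase s hs
        refine ⟨r, hr, ?_⟩
        simp [e, Algebra.smul_def, mul_comm]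
    obtain ⟨r, rfl⟩ := IsIntegrallyClosed.isIntegral_iff.mp hint
    exact Submodule.mem_one.mpr ⟨r, rfl⟩
  · push Not at hcase
    obtain ⟨u, huP, hu⟩ := hcase
    obtain ⟨v, hv⟩ := Submodule.mem_one.mp ((hmem u).mp huP)
    have hvu : IsUnit v := by
      by_contra h
      exact hu v (hPm ▸ h) hv
    have hspan : P = Ideal.span {u} := by
      refine le_antisymm (fun s hs ↦ ?_) ((Ideal.span_singleton_le_iff_mem _).mpr huP)
      obtain ⟨r, hr⟩ := Submodule.mem_one.mp ((hmem s).mp hs)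
      have : s * v = r * u := by
        apply IsFractionRing.injective S K
        simp only [map_mul, hv, hr, Algebra.smul_def]
        ring
      rw [Ideal.mem_span_singleton, ← hvu.dvd_mul_right, this]
      exact dvd_mul_left _ _
    have := Ideal.height_le_one_of_isPrincipal_of_mem_minimalPrimes (Ideal.span {u}) P (by
      rw [← hspan, Ideal.minimalPrimes_eq_subsingleton_self]; rfl)
    rw [hPm] at this
    exact absurd this (not_le.mpr hS)

/-- Let `p` be a prime of height at least two of a finitely generated domain `A`. If the elements
of `B` are regular at all primes strictly below `p`, then some prime of `B` lies over `p`. -/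
theorem exists_isPrime_comap_eq_of_finiteType (k : Type*) {A B : Type*} (K : Type*) [Field k]
    [CharZero k] [CommRing A] [IsDomain A] [Algebra k A] [Algebra.FiniteType k A] [CommRing B]
    [Field K] [Algebra A K] [IsFractionRing A K] [Algebra A B] [Algebra B K] [IsScalarTower A B K]
    (p₂ p₁ p : Ideal A) [p₂.IsPrime] [p₁.IsPrime] [p.IsPrime] (h₂₁ : p₂ < p₁) (h₁ : p₁ < p)
    (hB : ∀ q : Ideal A, q.IsPrime → q < p → ∀ b : B, ∃ s ∉ q, ∃ a : A,
      s • algebraMap B K b = algebraMap A K a) :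
    ∃ Q : Ideal B, Q.IsPrime ∧ Q.comap (algebraMap A B) = p := by
  let C := integralClosure A K
  have : Module.Finite A C := finite_integralClosure_of_finiteType k A K
  have : IsNoetherianRing A := Algebra.FiniteType.isNoetherianRing k A
  have : IsNoetherianRing C := .of_finite A C
  have : IsFractionRing C K :=
    have := IsLocalization.isAlgebraic K (nonZeroDivisors A)
    integralClosure.isFractionRing_of_algebraic fun x hx ↦
      IsFractionRing.injective A K (hx.trans (map_zero _).symm)
  have : IsIntegrallyClosed C := integralClosure.isIntegrallyClosedOfFiniteExtension K
  obtain ⟨n₂, -, hn₂, rfl⟩ := Ideal.exists_ideal_over_prime_of_isIntegral p₂ (⊥ : Ideal C)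
    fun x hx ↦ by
    rw [Ideal.mem_comap, Ideal.mem_bot,
      map_eq_zero_iff _ (FaithfulSMul.algebraMap_injective A C)] at hx
    exact hx ▸ p₂.zero_mem
  obtain ⟨n₁, hle₁, hn₁, rfl⟩ := Ideal.exists_ideal_over_prime_of_isIntegral p₁ n₂ h₂₁.le
  obtain ⟨n, hle, hn, rfl⟩ := Ideal.exists_ideal_over_prime_of_isIntegral p n₁ h₁.le
  have hlt₁ : n₂ < n₁ := lt_of_le_of_ne hle₁ (by rintro rfl; exact h₂₁.ne rfl)
  have hlt : n₁ < n := lt_of_le_of_ne hle (by rintro rfl; exact h₁.ne rfl)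
  let S := Localization.AtPrime n
  let _ : Algebra S K := IsLocalization.localizationAlgebraOfSubmonoidLe S K n.primeCompl
    (nonZeroDivisors C) n.primeCompl_le_nonZeroDivisors
  have : IsScalarTower C S K := IsLocalization.localization_isScalarTower_of_submonoid_le S K
    n.primeCompl (nonZeroDivisors C) n.primeCompl_le_nonZeroDivisors
  have : IsFractionRing S K :=
    IsFractionRing.isFractionRing_of_isDomain_of_isLocalization n.primeCompl S K
  have : IsScalarTower A S K := .of_algebraMap_eq fun a ↦ by
    rw [IsScalarTower.algebraMap_apply A C S, ← IsScalarTower.algebraMap_apply C S K]; rfl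
  have : IsNoetherianRing S := IsLocalization.isNoetherianRing n.primeCompl S inferInstance
  have : IsIntegrallyClosed S :=
    isIntegrallyClosed_of_isLocalization S n.primeCompl n.primeCompl_le_nonZeroDivisors
  have hunder : (IsLocalRing.maximalIdeal S).under C = n := Localization.AtPrime.under_maximalIdeal
  have hheight : 1 < (IsLocalRing.maximalIdeal S).height := by
    rw [← IsLocalization.height_under n.primeCompl, hunder]
    calc (1 : ℕ∞) < 1 + 1 := by norm_num
      _ ≤ n₁.height + 1 := by
        gcongr
        exact le_add_self.trans (Ideal.height_add_one_le_of_lt_of_isPrime hlt₁)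
      _ ≤ n.height := Ideal.height_add_one_le_of_lt_of_isPrime hlt
  have hmem (b : B) : algebraMap B K b ∈ (1 : Submodule S K) := by
    refine mem_range_algebraMap_of_forall_prime hheight _ fun P hP hne ↦ ?_
    have hPn : P.comap (algebraMap C S) < n := by
      refine lt_of_le_of_ne ?_ ?_
      · exact (Ideal.comap_mono (IsLocalRing.le_maximalIdeal hP.ne_top)).trans hunder.le
      · exact fun h ↦ hne (Localization.AtPrime.eq_maximalIdeal_iff_under_eq.mp h)
    obtain ⟨s, hs, a, ha⟩ := hB _ inferInstance (Ideal.IsIntegral.comap_lt_comap (R := A) hPn) b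
    refine ⟨algebraMap A S s, fun h ↦ hs h, Submodule.mem_one.mpr ⟨algebraMap A S a, ?_⟩⟩
    rw [← IsScalarTower.algebraMap_apply, ← ha, algebraMap_smul]
  let S' := (algebraMap S K).range
  let g : B →+* S' := (algebraMap B K).codRestrict S' fun b ↦ Submodule.mem_one.mp (hmem b)
  let e : S ≃+* S' := RingEquiv.ofBijective (algebraMap S K).rangeRestrict
    ⟨fun x y h ↦ IsFractionRing.injective S K (congrArg Subtype.val h),
      RingHom.rangeRestrict_surjective _⟩
  have hcomp : ((e.symm : S' →+* S).comp g).comp (algebraMap A B) =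
      (algebraMap C S).comp (algebraMap A C) := by
    ext a
    apply e.injective
    apply Subtype.ext
    change ((e (e.symm (g _)) : S') : K) = algebraMap S K _
    rw [e.apply_symm_apply]
    change algebraMap B K (algebraMap A B a) = _
    rw [RingHom.comp_apply, ← IsScalarTower.algebraMap_apply, ← IsScalarTower.algebraMap_apply,
      ← IsScalarTower.algebraMap_apply]
  refine ⟨(IsLocalRing.maximalIdeal S).comap ((e.symm : S' →+* S).comp g), inferInstance, ?_⟩
  rw [Ideal.comap_comap, hcomp, ← Ideal.comap_comap]
  exact congrArg (Ideal.comap (algebraMap A C)) hunder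

open AlgebraicGeometry CategoryTheory TopologicalSpace

/-- On a separated integral scheme locally of finite type over a field of characteristic zero, a
point of codimension at least two lies in every affine open containing all its proper
generizations. -/
theorem mem_affineOpen_of_generizations_mem {k : Type} [Field k] [CharZero k] {X : Scheme}
    [IsIntegral X] (f : X ⟶ Spec (CommRingCat.of k)) [IsSeparated f] [LocallyOfFiniteType f]
    {U : X.Opens} (hU : IsAffineOpen U) {x₂ x₁ η : X} (h₂₁ : x₂ ⤳ x₁) (hne₂₁ : x₂ ≠ x₁)
    (h₁ : x₁ ⤳ η) (hne₁ : x₁ ≠ η) (hgen : ∀ x, x ⤳ η → x ≠ η → x ∈ U) : η ∈ U := by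
  obtain ⟨V, hV, hηV, -⟩ := exists_isAffineOpen_mem_and_subset (U := (⊤ : X.Opens))
    (x := η) trivial
  have hx₁V : x₁ ∈ V := h₁.mem_open V.isOpen hηV
  have hx₂V : x₂ ∈ V := h₂₁.mem_open V.isOpen hx₁V
  let W := U ⊓ V
  have hW : IsAffineOpen W := isAffineHom_diagonal_iff.mp
    (inferInstance : IsAffineHom (Limits.pullback.diagonal f)) ⊤ (isAffineOpen_top _) U (by simp)
    V (by simp) hU hV
  have : Nonempty V := ⟨⟨η, hηV⟩⟩
  have : Nonempty W := ⟨⟨x₁, hgen _ h₁ hne₁, hx₁V⟩⟩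
  let i : Opposite.op V ⟶ Opposite.op W := (homOfLE inf_le_right : W ⟶ V).op
  let φ : k →+* Γ(X, V) := (f.appLE ⊤ V (by simp)).hom.comp
    (Scheme.ΓSpecIso (CommRingCat.of k)).inv.hom
  let _ : Algebra k Γ(X, V) := φ.toAlgebra
  have : Algebra.FiniteType k Γ(X, V) := by
    change φ.FiniteType
    refine (f.finiteType_appLE (isAffineOpen_top _) hV _).comp
      (RingHom.FiniteType.of_surjective _ ?_)
    exact (Scheme.ΓSpecIso (CommRingCat.of k)).symm.commRingCatIsoToRingEquiv.surjective
  let _ : Algebra Γ(X, V) Γ(X, W) := (X.presheaf.map i).hom.toAlgebra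
  have : IsFractionRing Γ(X, V) X.functionField :=
    functionField_isFractionRing_of_isAffineOpen X V hV
  have : IsScalarTower Γ(X, V) Γ(X, W) X.functionField := .of_algebraMap_eq fun a ↦ by
    change X.presheaf.germ V _ _ a = X.presheaf.germ W _ _ (X.presheaf.map i a)
    exact (X.presheaf.germ_res_apply (homOfLE inf_le_right : W ⟶ V) _ _ a).symm
  have hlt {x y : X} (hx : x ∈ V) (hy : y ∈ V) (h : x ⤳ y) (hne : x ≠ y) :
      (hV.primeIdealOf ⟨x, hx⟩).asIdeal < (hV.primeIdealOf ⟨y, hy⟩).asIdeal := by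
    change hV.primeIdealOf ⟨x, hx⟩ < hV.primeIdealOf ⟨y, hy⟩
    refine lt_of_le_of_ne ?_ fun e ↦ hne ?_
    · refine (PrimeSpectrum.le_iff_specializes _ _).mpr
        (hV.fromSpec.isOpenEmbedding.isInducing.specializes_iff.mp ?_)
      rwa [hV.fromSpec_primeIdealOf ⟨x, hx⟩, hV.fromSpec_primeIdealOf ⟨y, hy⟩]
    · simpa [hV.fromSpec_primeIdealOf] using congrArg hV.fromSpec e
  have hηe : hV.fromSpec (hV.primeIdealOf ⟨η, hηV⟩) = η := hV.fromSpec_primeIdealOf ⟨η, hηV⟩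
  obtain ⟨Q, hQ, hQη⟩ := exists_isPrime_comap_eq_of_finiteType k (B := Γ(X, W)) X.functionField
    _ _ _ (hlt hx₂V hx₁V h₂₁ hne₂₁) (hlt hx₁V hηV h₁ hne₁) (by
      intro q hq hqη b
      let y : Spec Γ(X, V) := ⟨q, hq⟩
      have hyV : hV.fromSpec y ∈ V := by
        have : hV.fromSpec y ∈ Set.range hV.fromSpec := ⟨y, rfl⟩
        rwa [hV.range_fromSpec] at this
      have hyη : hV.fromSpec y ⤳ η :=
        hηe ▸ ((PrimeSpectrum.le_iff_specializes _ _).mp hqη.le).map hV.fromSpec.continuous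
      have hyne : hV.fromSpec y ≠ η := fun h ↦ hqη.ne
        (congrArg PrimeSpectrum.asIdeal (hV.fromSpec.isOpenEmbedding.injective (h.trans hηe.symm)))
      have hyW : hV.fromSpec y ∈ W := ⟨hgen _ hyη hyne, hyV⟩
      let _ := TopCat.Presheaf.algebra_section_stalk X.presheaf (⟨hV.fromSpec y, hyV⟩ : V)
      obtain ⟨⟨a, s⟩, has⟩ := @IsLocalization.surj _ _ y.asIdeal.primeCompl _ _ _
        (hV.isLocalization_stalk' y hyV) (X.presheaf.germ W (hV.fromSpec y) hyW b)
      refine ⟨s, s.2, a, ?_⟩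
      have := congrArg (algebraMap (X.presheaf.stalk (hV.fromSpec y)) X.functionField) has
      rw [map_mul] at this
      erw [Scheme.algebraMap_germ_eq_germToFunctionField,
        Scheme.algebraMap_germ_eq_germToFunctionField,
        Scheme.algebraMap_germ_eq_germToFunctionField] at this
      rw [Algebra.smul_def, mul_comm]
      exact this)
  let z : Spec Γ(X, W) := ⟨Q, hQ⟩
  have hη : hW.fromSpec z = η := by
    rw [← hV.map_fromSpec hW i, Scheme.Hom.comp_apply]
    exact (congrArg hV.fromSpec (PrimeSpectrum.ext hQη)).trans hηe
  have : hW.fromSpec z ∈ Set.range hW.fromSpec := ⟨_, rfl⟩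
  rw [hη, hW.range_fromSpec] at this
  exact this.1

/-- The complement of an affine open subset in an irreducible proper variety of dimension `≥ 2`
has pure codimension one: every irreducible component of the closed complement `Z` has
codimension `1` in `X`. -/
theorem complement_of_affine_open_pure_codim_one
    (X : Scheme) [IsIntegral X] [NoetherianSpace X]
    (f : X ⟶ Spec (CommRingCat.of ℂ)) [IsProper f]
    (hdim : 2 ≤ topologicalKrullDim X)
    (Z : Set X) (hZcl : IsClosed Z) (hZne : Z.Nonempty) (hZproper : Z ≠ Set.univ)
    (hUaff : IsAffineOpen ⟨Zᶜ, hZcl.isOpen_compl⟩)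
    (T : Set X) (hTirr : IsIrreducible T) (hTcl : IsClosed T) (hTZ : T ⊆ Z)
    (hTmax : ∀ T' : Set X, T ⊆ T' → T' ⊆ Z → IsIrreducible T' → T' = T) :
    Order.coheight (⟨T, hTirr, hTcl⟩ : IrreducibleCloseds X) = 1 := by
  apply le_antisymm
  · by_contra hcon
    have h2 : ((2 : ℕ) : ℕ∞) ≤ Order.coheight (⟨T, hTirr, hTcl⟩ : IrreducibleCloseds X) := by
      simpa [one_add_one_eq_two] using Order.add_one_le_of_lt (not_le.mp hcon)
    obtain ⟨c, hc0, hc⟩ := Order.exists_series_of_le_coheight _ h2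
    have hlt₁ : c 0 < c ⟨1, by omega⟩ := c.strictMono (by simp [Fin.lt_def])
    have hlt₂ : c ⟨1, by omega⟩ < c ⟨2, by omega⟩ := c.strictMono (by simp [Fin.lt_def])
    change c 0 = _ at hc0
    rw [hc0] at hlt₁
    generalize c ⟨1, _⟩ = T₁ at hlt₁ hlt₂
    generalize c ⟨2, _⟩ = T₂ at hlt₂
    obtain ⟨η, hη⟩ := QuasiSober.sober hTirr hTcl
    obtain ⟨x₁, hx₁⟩ := QuasiSober.sober T₁.isIrreducible T₁.isClosed
    obtain ⟨x₂, hx₂⟩ := QuasiSober.sober T₂.isIrreducible T₂.isClosed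
    refine mem_affineOpen_of_generizations_mem f hUaff (η := η) (hx₂.specializes (hlt₂.le hx₁.mem))
      ?_ (hx₁.specializes (hlt₁.le hη.mem)) ?_ ?_ (hTZ hη.mem)
    · rintro rfl
      exact hlt₂.ne (SetLike.coe_injective (hx₁.def.symm.trans hx₂.def))
    · rintro rfl
      exact hlt₁.ne (SetLike.coe_injective (hη.def.symm.trans hx₁.def))
    · intro x hx hne hxZ
      have hTx : T ⊆ closure {x} := (hη.mem_closed_set_iff isClosed_closure).mp hx.mem_closure
      have := hTmax _ hTx (hZcl.closure_subset_iff.mpr (by simpa using hxZ))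
        isIrreducible_singleton.closure
      exact hne (IsGenericPoint.eq this hη)
  · rw [Order.one_le_iff_pos, Order.coheight_pos, not_isMax_iff]
    refine ⟨⟨Set.univ, IrreducibleSpace.isIrreducible_univ X, isClosed_univ⟩, ?_⟩
    refine lt_of_le_of_ne (Set.subset_univ T) fun h ↦ hZproper ?_
    have : T = Set.univ := congrArg IrreducibleCloseds.carrier h
    exact Set.univ_subset_iff.mp (this ▸ hTZ)
end

section
/- Let X be an affine variety over ℂ and Y ⊆ X a closed subvariety. If X̄ is any irreducible complete variety containing Y as an open subset and dim Y ≥ 2, then X̄ \ Y is connected. -/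
open AlgebraicGeometry CategoryTheory TopologicalSpace

section Algebra

variable {k K : Type*} [Field k] [Field K] [Algebra k K]

/-- A finitely generated subalgebra of a field `K` with fraction field `K`. -/
def IsAffineModel (B : Subalgebra k K) : Prop :=
  B.FG ∧ ∀ y : K, ∃ a ∈ B, ∃ b ∈ B, b ≠ 0 ∧ y = a / b

lemma IsAffineModel.of_le {B C : Subalgebra k K} (hB : IsAffineModel B) (h : B ≤ C) (hC : C.FG) :
    IsAffineModel C :=
  ⟨hC, fun y ↦ by
    obtain ⟨a, ha, b, hb, hb0, rfl⟩ := hB.2 y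
    exact ⟨a, h ha, b, h hb, hb0, rfl⟩⟩

lemma ValuationSubring.mem_of_isIntegral {R : Type*} [CommRing R] [Algebra R K]
    (V : ValuationSubring K) (hV : ∀ r : R, algebraMap R K r ∈ V) {y : K} (hy : IsIntegral R y) :
    y ∈ V := by
  have h : IsIntegral V y := by
    let f : R →+* V := (algebraMap R K).codRestrict V.toSubring hV
    obtain ⟨p, hp, hpy⟩ := hy
    refine ⟨p.map f, hp.map f, ?_⟩
    rw [Polynomial.eval₂_map]
    exact hpy
  obtain ⟨z, rfl⟩ := IsIntegrallyClosed.isIntegral_iff.mp h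
  exact z.2

lemma isIntegral_of_forall_mem_valuationSubring (B : Subalgebra k K) {y : K}
    (h : ∀ V : ValuationSubring K, (∀ b ∈ B, b ∈ V) → y ∈ V) : IsIntegral B y := by
  have h1 : y ∈ ⨅ V : {V : ValuationSubring K // (B : Set K) ⊆ V.toSubring}, V.1.toSubring := by
    rw [Subring.mem_iInf]
    exact fun V ↦ h V.1 V.2
  rw [iInf_valuationSubring_superset] at h1
  have h2 : Subring.closure (B : Set K) = B.toSubring := Subring.closure_eq B.toSubring
  rw [h2] at h1
  exact h1

lemma ValuationSubring.mem_of_isIntegral_subalgebra {B : Subalgebra k K} (V : ValuationSubring K)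
    (hV : ∀ b ∈ B, b ∈ V) {y : K} (hy : IsIntegral B y) : y ∈ V :=
  V.mem_of_isIntegral (fun r ↦ hV r.1 r.2) hy

lemma IsAffineModel.finiteDimensional {B : Subalgebra k K} (hB : IsAffineModel B)
    (P L : Type*) [CommRing P] [Field L] [Algebra k P] [Algebra P L] [Algebra P K]
    [Algebra L K] [IsScalarTower P L K] [IsScalarTower k P K]
    (h : ∀ b ∈ B, IsIntegral P b) : FiniteDimensional L K := by
  obtain ⟨⟨s, hs⟩, hfrac⟩ := hB
  have hint : ∀ y ∈ (s : Set K), IsIntegral L y := fun y hy ↦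
    (h y (hs ▸ Algebra.subset_adjoin hy)).tower_top
  have hfd : FiniteDimensional L (IntermediateField.adjoin L (s : Set K)) :=
    IntermediateField.finiteDimensional_adjoin hint
  have hle : ∀ b ∈ B, b ∈ IntermediateField.adjoin L (s : Set K) := by
    intro b hb
    rw [← hs] at hb
    induction hb using Algebra.adjoin_induction with
    | mem x hx => exact IntermediateField.subset_adjoin _ _ hx
    | algebraMap r =>
      rw [IsScalarTower.algebraMap_apply k P K, IsScalarTower.algebraMap_apply P L K]
      exact IntermediateField.algebraMap_mem _ _
    | add x y _ _ hx hy => exact add_mem hx hy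
    | mul x y _ _ hx hy => exact mul_mem hx hy
  have htop : IntermediateField.adjoin L (s : Set K) = ⊤ := by
    rw [eq_top_iff]
    intro y _
    obtain ⟨a, ha, b, hb, -, rfl⟩ := hfrac y
    exact div_mem (hle a ha) (hle b hb)
  rw [htop] at hfd
  exact Module.Finite.equiv (IntermediateField.topEquiv (F := L) (E := K)).toLinearEquiv

/-- The conductor of a finitely generated domain is nonzero. -/
lemma IsAffineModel.exists_conductor [CharZero k] {B : Subalgebra k K} (hB : IsAffineModel B) :
    ∃ E ∈ B, E ≠ 0 ∧ ∀ y : K, IsIntegral B y → E * y ∈ B := by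
  have hft : Algebra.FiniteType k B := (Subalgebra.fg_iff_finiteType B).mp hB.1
  obtain ⟨s, g, hg, hgf⟩ := exists_integral_inj_algHom_of_fg k B
  let P := MvPolynomial (Fin s) k
  let φ : P →ₐ[k] K := B.val.comp g
  have hφ : Function.Injective φ := Subtype.val_injective.comp hg
  let : Algebra P B := g.toRingHom.toAlgebra
  let : Algebra P K := φ.toRingHom.toAlgebra
  have : IsScalarTower P B K := IsScalarTower.of_algebraMap_eq' rfl
  have : IsScalarTower k P K := IsScalarTower.of_algebraMap_eq' φ.comp_algebraMap.symm
  have : FaithfulSMul P K := (faithfulSMul_iff_algebraMap_injective P K).mpr hφ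
  have : Algebra.IsIntegral P B := ⟨hgf⟩
  let L := FractionRing P
  let : Algebra L K := FractionRing.liftAlgebra P K
  have : IsScalarTower P L K := FractionRing.isScalarTower_liftAlgebra P K
  have hBP : ∀ b ∈ B, IsIntegral P b := fun b hb ↦
    (Algebra.IsIntegral.isIntegral (R := P) (⟨b, hb⟩ : B)).map (IsScalarTower.toAlgHom P B K)
  have : FiniteDimensional L K := hB.finiteDimensional P L hBP
  have : CharZero L := charZero_of_injective_algebraMap (R := k)
    (FaithfulSMul.algebraMap_injective k L)
  have := IsIntegralClosure.finite P L K (integralClosure P K)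
  obtain ⟨t, ht⟩ := this.fg_top
  choose num hnum den hden hden0 hfrac using hB.2
  refine ⟨∏ z ∈ t, den z.1, prod_mem fun z _ ↦ hden _, Finset.prod_ne_zero_iff.mpr
    fun z _ ↦ hden0 _, fun y hy ↦ ?_⟩
  have hyP : IsIntegral P y := isIntegral_trans y hy
  have hmem : (⟨y, hyP⟩ : integralClosure P K) ∈ Submodule.span P (t : Set _) := ht ▸ trivial
  have key : ∀ z ∈ Submodule.span P (t : Set (integralClosure P K)),
      (∏ z ∈ t, den z.1) * z.1 ∈ B := by
    intro z hz
    induction hz using Submodule.span_induction with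
    | mem x hx =>
      classical
      rw [← Finset.mul_prod_erase t (fun z ↦ den z.1) hx, mul_comm, ← mul_assoc]
      refine mul_mem ?_ (prod_mem fun z _ ↦ hden _)
      nth_rewrite 1 [hfrac x.1]
      rw [div_mul_cancel₀ _ (hden0 _)]
      exact hnum _
    | zero => simp
    | add x y _ _ hx hy =>
      rw [show (x + y : integralClosure P K).1 = x.1 + y.1 from rfl, mul_add]
      exact add_mem hx hy
    | smul a x _ hx =>
      rw [show (a • x : integralClosure P K).1 = (g a).1 * x.1 from Algebra.smul_def a x.1,
        mul_left_comm]
      exact mul_mem (g a).2 hx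
  exact key _ hmem

lemma IsAffineModel.mem_of_forall_mul_pow_mem [CharZero k] {B : Subalgebra k K}
    (hB : IsAffineModel B) {w y : K} (hw : w ≠ 0)
    (h : ∀ m : ℕ, ∀ V : ValuationSubring K, (∀ b ∈ B, b ∈ V) → w * y ^ m ∈ V)
    (V : ValuationSubring K) (hV : ∀ b ∈ B, b ∈ V) : y ∈ V := by
  obtain ⟨E, hE, hE0, hc⟩ := hB.exists_conductor
  have hft : Algebra.FiniteType k B := (Subalgebra.fg_iff_finiteType B).mp hB.1
  have : IsNoetherianRing B := Algebra.FiniteType.isNoetherianRing k B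
  obtain ⟨a, ha, b, hb, hb0, hwab⟩ := hB.2 w
  have ha0 : a ≠ 0 := by rintro rfl; simp_all
  refine V.mem_of_isIntegral_subalgebra hV (IsAlmostIntegral.isIntegral
    ⟨⟨E * a, mul_mem hE ha⟩, ?_, fun m ↦ ?_⟩)
  · rw [mem_nonZeroDivisors_iff_ne_zero]
    exact fun h ↦ mul_ne_zero hE0 ha0 (congrArg Subtype.val h)
  · have h1 := mul_mem hb (hc _ (isIntegral_of_forall_mem_valuationSubring B (h m)))
    refine ⟨⟨_, h1⟩, ?_⟩
    rw [Algebra.smul_def]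
    change b * (E * (w * y ^ m)) = E * a * y ^ m
    rw [hwab]; field_simp

end Algebra

section Algebra

variable {k K : Type*} [Field k] [Field K] [Algebra k K]

/-- The subalgebra obtained by adding one element. -/
def adjoinElem (B : Subalgebra k K) (u : K) : Subalgebra k K := B ⊔ Algebra.adjoin k {u}

lemma le_adjoinElem (B : Subalgebra k K) (u : K) : B ≤ adjoinElem B u := le_sup_left

lemma self_mem_adjoinElem (B : Subalgebra k K) (u : K) : u ∈ adjoinElem B u :=
  (le_sup_right : Algebra.adjoin k {u} ≤ adjoinElem B u) (Algebra.subset_adjoin rfl)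

lemma adjoinElem_fg {B : Subalgebra k K} (hB : B.FG) (u : K) : (adjoinElem B u).FG :=
  hB.sup ⟨{u}, by simp⟩

lemma mem_valuationSubring_of_mem_adjoin {s : Set K} {V : ValuationSubring K}
    (hk : ∀ c : k, algebraMap k K c ∈ V) (hs : ∀ b ∈ s, b ∈ V) :
    ∀ b ∈ Algebra.adjoin k s, b ∈ V := by
  intro b hb
  induction hb using Algebra.adjoin_induction with
  | mem x hx => exact hs x hx
  | algebraMap r => exact hk r
  | add x y _ _ hx hy => exact add_mem hx hy
  | mul x y _ _ hx hy => exact mul_mem hx hy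

lemma mem_valuationSubring_of_mem_adjoinElem {B : Subalgebra k K} {u : K}
    {V : ValuationSubring K} (hB : ∀ b ∈ B, b ∈ V) (hu : u ∈ V) :
    ∀ b ∈ adjoinElem B u, b ∈ V := by
  have h : adjoinElem B u = Algebra.adjoin k ((B : Set K) ∪ {u}) := by
    rw [Algebra.adjoin_union, Algebra.adjoin_eq]; rfl
  rw [h]
  exact mem_valuationSubring_of_mem_adjoin (fun c ↦ hB _ (B.algebraMap_mem c))
    (by rintro b (hb | rfl); exacts [hB b hb, hu])

/-- `B[u, u⁻¹] = B[u] + B[u⁻¹]`. -/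
lemma exists_add_of_mem_adjoinElem_inv {B : Subalgebra k K} {u : K} (hu : u ≠ 0) {y : K}
    (hy : y ∈ adjoinElem (adjoinElem B u) u⁻¹) :
    ∃ a ∈ adjoinElem B u, ∃ b ∈ adjoinElem B u⁻¹, y = a + b := by
  have hdec : ∀ v : K, ∀ z ∈ adjoinElem B v, ∃ b ∈ B, ∃ w ∈ adjoinElem B v, z = b + v * w := by
    intro v z hz
    have h : adjoinElem B v = Algebra.adjoin k ((B : Set K) ∪ {v}) := by
      rw [Algebra.adjoin_union, Algebra.adjoin_eq]; rfl
    rw [h] at hz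
    induction hz using Algebra.adjoin_induction with
    | mem x hx =>
      rcases hx with hx | rfl
      · exact ⟨x, hx, 0, zero_mem _, by simp⟩
      · exact ⟨0, zero_mem _, 1, one_mem _, by simp⟩
    | algebraMap r => exact ⟨_, B.algebraMap_mem r, 0, zero_mem _, by simp⟩
    | add x y _ _ hx hy =>
      obtain ⟨b, hb, w, hw, rfl⟩ := hx
      obtain ⟨b', hb', w', hw', rfl⟩ := hy
      exact ⟨b + b', add_mem hb hb', w + w', add_mem hw hw', by ring⟩
    | mul x y _ _ hx hy =>
      obtain ⟨b, hb, w, hw, rfl⟩ := hx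
      obtain ⟨b', hb', w', hw', rfl⟩ := hy
      have hv := self_mem_adjoinElem B v
      have h1 := le_adjoinElem B v hb
      have h2 := le_adjoinElem B v hb'
      exact ⟨b * b', mul_mem hb hb', b * w' + b' * w + v * w * w',
        add_mem (add_mem (mul_mem h1 hw') (mul_mem h2 hw)) (mul_mem (mul_mem hv hw) hw'),
        by ring⟩
  let M : Set K := {y | ∃ a ∈ adjoinElem B u, ∃ b ∈ adjoinElem B u⁻¹, y = a + b}
  have hadd : ∀ x ∈ M, ∀ y ∈ M, x + y ∈ M := by
    rintro _ ⟨a, ha, b, hb, rfl⟩ _ ⟨a', ha', b', hb', rfl⟩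
    exact ⟨a + a', add_mem ha ha', b + b', add_mem hb hb', by ring⟩
  have hMB : ∀ c ∈ B, ∀ m ∈ M, c * m ∈ M := by
    rintro c hc _ ⟨a, ha, b, hb, rfl⟩
    exact ⟨c * a, mul_mem (le_adjoinElem _ _ hc) ha, c * b, mul_mem (le_adjoinElem _ _ hc) hb,
      by ring⟩
  have hMu : ∀ m ∈ M, u * m ∈ M := by
    rintro _ ⟨a, ha, b, hb, rfl⟩
    obtain ⟨b₀, hb₀, w, hw, rfl⟩ := hdec _ b hb
    exact ⟨u * a + u * b₀, add_mem (mul_mem (self_mem_adjoinElem _ _) ha)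
      (mul_mem (self_mem_adjoinElem _ _) (le_adjoinElem _ _ hb₀)), w, hw, by field_simp; ring⟩
  have hMu' : ∀ m ∈ M, u⁻¹ * m ∈ M := by
    rintro _ ⟨a, ha, b, hb, rfl⟩
    obtain ⟨a₀, ha₀, w, hw, rfl⟩ := hdec _ a ha
    exact ⟨w, hw, u⁻¹ * a₀ + u⁻¹ * b, add_mem (mul_mem (self_mem_adjoinElem _ _)
      (le_adjoinElem _ _ ha₀)) (mul_mem (self_mem_adjoinElem _ _) hb), by field_simp; ring⟩
  have h : adjoinElem (adjoinElem B u) u⁻¹ = Algebra.adjoin k (((B : Set K) ∪ {u}) ∪ {u⁻¹}) := by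
    rw [Algebra.adjoin_union, Algebra.adjoin_union, Algebra.adjoin_eq]; rfl
  rw [h] at hy
  have key : ∀ m ∈ M, y * m ∈ M := by
    induction hy using Algebra.adjoin_induction with
    | mem x hx =>
      rcases hx with (hx | rfl) | rfl
      exacts [hMB x hx, hMu, hMu']
    | algebraMap r => exact hMB _ (B.algebraMap_mem r)
    | add x y _ _ hx hy =>
      intro m hm
      rw [add_mul]
      exact hadd _ (hx m hm) _ (hy m hm)
    | mul x y _ _ hx hy =>
      intro m hm
      rw [mul_assoc]
      exact hx _ (hy m hm)
  have h1 := key 1 ⟨1, one_mem _, 0, zero_mem _, by simp⟩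
  rwa [mul_one] at h1

/-- The elements of `B` approximate, to every order in `t`, the element `D` on the valuation rings
in `T₁` and the element `0` on those in `T₂`. -/
def SeparatesWith (T₁ T₂ : ValuationSubring K → Prop) (t : K) (B : Subalgebra k K) (D : K) :
    Prop :=
  ∀ n : ℕ, ∃ g ∈ B, ∀ V : ValuationSubring K, (∀ b ∈ B, b ∈ V) →
    (T₁ V → (g - D) / t ^ n ∈ V) ∧ (T₂ V → g / t ^ n ∈ V)

lemma SeparatesWith.mul {T₁ T₂ : ValuationSubring K → Prop} {t : K} {B : Subalgebra k K} {D : K}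
    (h : SeparatesWith T₁ T₂ t B D) {b : K} (hb : b ∈ B) :
    SeparatesWith T₁ T₂ t B (b * D) := by
  intro n
  obtain ⟨g, hg, hgV⟩ := h n
  refine ⟨b * g, mul_mem hb hg, fun V hV ↦ ⟨fun h1 ↦ ?_, fun h2 ↦ ?_⟩⟩
  · rw [← mul_sub, mul_div_assoc]
    exact mul_mem (hV b hb) ((hgV V hV).1 h1)
  · rw [mul_div_assoc]
    exact mul_mem (hV b hb) ((hgV V hV).2 h2)

lemma IsAffineModel.exists_separatesWith_mem {T₁ T₂ : ValuationSubring K → Prop} {t : K}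
    {B C : Subalgebra k K} (hB : IsAffineModel B) (hBC : B ≤ C) {D : K} (hD : D ≠ 0)
    (h : SeparatesWith T₁ T₂ t C D) : ∃ D ∈ B, D ≠ 0 ∧ SeparatesWith T₁ T₂ t C D := by
  obtain ⟨a, ha, b, hb, hb0, rfl⟩ := hB.2 D
  refine ⟨a, ha, by rintro rfl; simp at hD, ?_⟩
  have := h.mul (hBC hb)
  rwa [mul_div_cancel₀ _ hb0] at this

lemma IsAffineModel.exists_conductor_of_le [CharZero k] {B C : Subalgebra k K}
    (hB : IsAffineModel B) (hBC : B ≤ C) (hC : C.FG) :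
    ∃ E ∈ B, E ≠ 0 ∧ ∀ y : K, IsIntegral C y → E * y ∈ C := by
  obtain ⟨E, hE, hE0, h⟩ := (hB.of_le hBC hC).exists_conductor
  obtain ⟨a, ha, b, hb, hb0, rfl⟩ := hB.2 E
  refine ⟨a, ha, by rintro rfl; simp at hE0, fun y hy ↦ ?_⟩
  have := mul_mem (hBC hb) (h y hy)
  rwa [← mul_assoc, mul_div_cancel₀ _ hb0] at this

lemma IsAffineModel.exists_separatesWith_of_adjoinElem [CharZero k]
    {T₁ T₂ : ValuationSubring K → Prop} {t : K} (ht : t ≠ 0) {B : Subalgebra k K}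
    (hB : IsAffineModel B) (htB : t ∈ B)
    (hT : ∀ V : ValuationSubring K, (∀ b ∈ B, b ∈ V) → T₁ V ∨ T₂ V ∨ t⁻¹ ∈ V) {u : K}
    (h₁ : ∃ D, D ≠ 0 ∧ SeparatesWith T₁ T₂ t (adjoinElem B u) D)
    (h₂ : ∃ D, D ≠ 0 ∧ SeparatesWith T₁ T₂ t (adjoinElem B u⁻¹) D) :
    ∃ D, D ≠ 0 ∧ SeparatesWith T₁ T₂ t B D := by
  by_cases hu : u = 0
  · subst hu
    have : adjoinElem B (0 : K) = B := by
      rw [adjoinElem, sup_eq_left]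
      exact Algebra.adjoin_le (by simp)
    rwa [this] at h₁
  obtain ⟨D₁, hD₁0, hD₁⟩ := h₁
  obtain ⟨D₂, hD₂0, hD₂⟩ := h₂
  obtain ⟨D₁, hD₁B, hD₁0, hD₁⟩ := hB.exists_separatesWith_mem (le_adjoinElem _ _) hD₁0 hD₁
  obtain ⟨D₂, hD₂B, hD₂0, hD₂⟩ := hB.exists_separatesWith_mem (le_adjoinElem _ _) hD₂0 hD₂
  set C := adjoinElem (adjoinElem B u) u⁻¹ with hCdef
  have hBC : B ≤ C := (le_adjoinElem B u).trans (le_adjoinElem _ _)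
  have hCu : ∀ b ∈ adjoinElem B u, b ∈ C := le_adjoinElem _ _
  have hCu' : adjoinElem B u⁻¹ ≤ C :=
    sup_le hBC (le_sup_right (a := adjoinElem B u) (b := Algebra.adjoin k {u⁻¹}))
  obtain ⟨E, hEB, hE0, hE⟩ :=
    hB.exists_conductor_of_le hBC (adjoinElem_fg (adjoinElem_fg hB.1 _) _)
  obtain ⟨F, hFB, hF0, hF⟩ := hB.exists_conductor
  refine ⟨F * E * D₁ * D₂, mul_ne_zero (mul_ne_zero (mul_ne_zero hF0 hE0) hD₁0) hD₂0, fun n ↦ ?_⟩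
  obtain ⟨g₁, hg₁, hg₁V⟩ := hD₁ n
  obtain ⟨g₂, hg₂, hg₂V⟩ := hD₂ n
  have htn : t ^ n ≠ 0 := pow_ne_zero _ ht
  have hint : IsIntegral C ((D₂ * g₁ - D₁ * g₂) / t ^ n) := by
    refine isIntegral_of_forall_mem_valuationSubring C fun V hV ↦ ?_
    have hV₁ := hg₁V V fun b hb ↦ hV b (hCu b hb)
    have hV₂ := hg₂V V fun b hb ↦ hV b (hCu' hb)
    have hVD₁ := hV _ (hBC hD₁B)
    have hVD₂ := hV _ (hBC hD₂B)
    rcases hT V fun b hb ↦ hV b (hBC hb) with h | h | h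
    · convert sub_mem (mul_mem hVD₂ (hV₁.1 h)) (mul_mem hVD₁ (hV₂.1 h)) using 1
      field_simp; ring
    · convert sub_mem (mul_mem hVD₂ (hV₁.2 h)) (mul_mem hVD₁ (hV₂.2 h)) using 1
      field_simp
    · rw [div_eq_mul_inv, ← inv_pow]
      exact mul_mem (sub_mem (mul_mem hVD₂ (hV _ (hCu _ hg₁))) (mul_mem hVD₁ (hV _ (hCu' hg₂))))
        (pow_mem h n)
  obtain ⟨c₁, hc₁, c₂, hc₂, hc⟩ := exists_add_of_mem_adjoinElem_inv hu (hE _ hint)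
  have hc' : E * D₂ * g₁ - t ^ n * c₁ = E * D₁ * g₂ + t ^ n * c₂ := by
    field_simp at hc; linear_combination hc
  have hEV : ∀ V : ValuationSubring K, (∀ b ∈ B, b ∈ V) →
      (∀ b ∈ adjoinElem B u, b ∈ V) ∨ (∀ b ∈ adjoinElem B u⁻¹, b ∈ V) := fun V hV ↦
    (V.mem_or_inv_mem u).imp (mem_valuationSubring_of_mem_adjoinElem hV)
      (mem_valuationSubring_of_mem_adjoinElem hV)
  refine ⟨F * (E * D₂ * g₁ - t ^ n * c₁), hF _ ?_, fun V hV ↦ ?_⟩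
  · refine isIntegral_of_forall_mem_valuationSubring B fun V hV ↦ ?_
    rcases hEV V hV with h | h
    · exact sub_mem (mul_mem (mul_mem (hV _ hEB) (hV _ hD₂B)) (h _ hg₁))
        (mul_mem (pow_mem (hV _ htB) _) (h _ hc₁))
    · rw [hc']
      exact add_mem (mul_mem (mul_mem (hV _ hEB) (hV _ hD₁B)) (h _ hg₂))
        (mul_mem (pow_mem (hV _ htB) _) (h _ hc₂))
  · have hVF := hV _ hFB
    have hVE := hV _ hEB
    have hVD₁ := hV _ hD₁B
    have hVD₂ := hV _ hD₂B
    rcases hEV V hV with h | h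
    · refine ⟨fun h1 ↦ ?_, fun h2 ↦ ?_⟩
      · convert sub_mem (mul_mem (mul_mem hVF (mul_mem hVE hVD₂)) ((hg₁V V h).1 h1))
          (mul_mem hVF (h _ hc₁)) using 1
        field_simp; ring
      · convert sub_mem (mul_mem (mul_mem hVF (mul_mem hVE hVD₂)) ((hg₁V V h).2 h2))
          (mul_mem hVF (h _ hc₁)) using 1
        field_simp
    · rw [hc']
      refine ⟨fun h1 ↦ ?_, fun h2 ↦ ?_⟩
      · convert add_mem (mul_mem (mul_mem hVF (mul_mem hVE hVD₁)) ((hg₂V V h).1 h1))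
          (mul_mem hVF (h _ hc₂)) using 1
        field_simp; ring
      · convert add_mem (mul_mem (mul_mem hVF (mul_mem hVE hVD₁)) ((hg₂V V h).2 h2))
          (mul_mem hVF (h _ hc₂)) using 1
        field_simp

lemma IsAffineModel.exists_separatesWith_of_forall [CharZero k]
    {T₁ T₂ : ValuationSubring K → Prop} {t : K} (ht : t ≠ 0) (l : List K) :
    ∀ {B : Subalgebra k K}, IsAffineModel B → t ∈ B →
    (∀ V : ValuationSubring K, (∀ b ∈ B, b ∈ V) → T₁ V ∨ T₂ V ∨ t⁻¹ ∈ V) →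
    (∀ C : Subalgebra k K, B ≤ C → C.FG → (∀ u ∈ l, u ∈ C ∨ u⁻¹ ∈ C) →
      ∃ D, D ≠ 0 ∧ SeparatesWith T₁ T₂ t C D) →
    ∃ D, D ≠ 0 ∧ SeparatesWith T₁ T₂ t B D := by
  induction l with
  | nil => exact fun hB _ _ h ↦ h _ le_rfl hB.1 (by simp)
  | cons u l ih =>
    intro B hB htB hT h
    have aux : ∀ v : K, (v = u ∨ v = u⁻¹) →
        ∃ D, D ≠ 0 ∧ SeparatesWith T₁ T₂ t (adjoinElem B v) D := by
      intro v hv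
      refine ih (hB.of_le (le_adjoinElem B v) (adjoinElem_fg hB.1 v)) (le_adjoinElem B v htB)
        (fun V hV ↦ hT V fun b hb ↦ hV b (le_adjoinElem B v hb)) fun C hC hCfg hCl ↦
        h C ((le_adjoinElem B v).trans hC) hCfg fun w hw ↦ ?_
      have hvC := hC (self_mem_adjoinElem B v)
      rcases List.mem_cons.mp hw with rfl | hw
      · rcases hv with rfl | rfl
        exacts [Or.inl hvC, Or.inr hvC]
      · exact hCl w hw
    exact hB.exists_separatesWith_of_adjoinElem ht htB hT (aux u (.inl rfl)) (aux u⁻¹ (.inr rfl))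

end Algebra

section Algebra

variable {k K : Type*} [Field k] [Field K] [Algebra k K]

/-- The elements of `B` lying in the maximal ideal of every valuation ring `V ⊇ B` in `T`. -/
def nonunitsIdeal (T : ValuationSubring K → Prop) (B : Subalgebra k K) : Ideal B where
  carrier := {b | ∀ V : ValuationSubring K, (∀ b ∈ B, b ∈ V) → T V → V.valuation b < 1}
  zero_mem' := fun V _ _ ↦ by simp
  add_mem' := fun {a b} ha hb V hV hT ↦ by
    rw [Subalgebra.coe_add]
    exact V.valuation.map_add_lt (ha V hV hT) (hb V hV hT)
  smul_mem' := fun c x hx V hV hT ↦ by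
    rw [smul_eq_mul, Subalgebra.coe_mul, map_mul]
    exact mul_lt_one_of_nonneg_of_lt_one_right ((V.valuation_le_one_iff _).mpr (hV c c.2)) zero_le (hx V hV hT)

lemma exists_pow_mul_mem_of_mem_adjoinElem_inv {B : Subalgebra k K} {v : K} (hv : v ∈ B)
    (hv0 : v ≠ 0) {y : K} (hy : y ∈ adjoinElem B v⁻¹) : ∃ N : ℕ, v ^ N * y ∈ B := by
  have h : adjoinElem B v⁻¹ = Algebra.adjoin k ((B : Set K) ∪ {v⁻¹}) := by
    rw [Algebra.adjoin_union, Algebra.adjoin_eq]; rfl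
  rw [h] at hy
  induction hy using Algebra.adjoin_induction with
  | mem x hx =>
    rcases hx with hx | rfl
    · exact ⟨0, by simpa using hx⟩
    · exact ⟨1, by simp [hv0]⟩
  | algebraMap r => exact ⟨0, by simp⟩
  | add x y _ _ hx hy =>
    obtain ⟨N, hN⟩ := hx
    obtain ⟨M, hM⟩ := hy
    refine ⟨N + M, ?_⟩
    rw [show v ^ (N + M) * (x + y) = v ^ M * (v ^ N * x) + v ^ N * (v ^ M * y) by ring]
    exact add_mem (mul_mem (pow_mem hv _) hN) (mul_mem (pow_mem hv _) hM)
  | mul x y _ _ hx hy =>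
    obtain ⟨N, hN⟩ := hx
    obtain ⟨M, hM⟩ := hy
    refine ⟨N + M, ?_⟩
    rw [show v ^ (N + M) * (x * y) = (v ^ N * x) * (v ^ M * y) by ring]
    exact mul_mem hN hM

lemma exists_separatesWith_of_mem_or_inv_mem {T₁ T₂ : ValuationSubring K → Prop} {t : K}
    (ht : t ≠ 0) {ι : Type*} [Finite ι] (S : ι → Finset K)
    (hS : ∀ V : ValuationSubring K, (∀ c : k, algebraMap k K c ∈ V) → ∃ j, ∀ b ∈ S j, b ∈ V)
    (hST : ∀ j, (∀ V : ValuationSubring K, (∀ c : k, algebraMap k K c ∈ V) →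
        (∀ b ∈ S j, b ∈ V) → ¬ T₁ V) ∨
      (∀ V : ValuationSubring K, (∀ c : k, algebraMap k K c ∈ V) →
        (∀ b ∈ S j, b ∈ V) → ¬ T₂ V))
    {B : Subalgebra k K} (htB : t ∈ B)
    (hT : ∀ V : ValuationSubring K, (∀ b ∈ B, b ∈ V) → T₁ V ∨ T₂ V ∨ t⁻¹ ∈ V)
    (hB : ∀ j, ∀ b ∈ S j, b ∈ B ∨ b⁻¹ ∈ B) : SeparatesWith T₁ T₂ t B 1 := by
  classical
  have htop : nonunitsIdeal T₁ B ⊔ nonunitsIdeal T₂ B = ⊤ := by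
    by_contra hne
    set I := nonunitsIdeal T₁ B ⊔ nonunitsIdeal T₂ B with hI
    obtain ⟨V, hBV, hIV⟩ := I.image_subset_nonunits_valuationSubring (A := B.toSubring) hne
    have hBV' : ∀ b ∈ B, b ∈ V := hBV
    have hk : ∀ V : ValuationSubring K, (∀ b ∈ B, b ∈ V) → ∀ c : k, algebraMap k K c ∈ V :=
      fun V hV c ↦ hV _ (B.algebraMap_mem c)
    obtain ⟨j, hj⟩ := hS V (hk V hBV')
    let f : K → K := fun b ↦ if b ∈ B then 1 else b⁻¹
    have hf : ∀ b ∈ S j, f b ∈ B := by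
      intro b hb
      by_cases h : b ∈ B
      · simp [f, h]
      · simpa [f, h] using (hB j b hb).resolve_left h
    have hf0 : ∀ b ∈ S j, f b ≠ 0 := by
      intro b hb
      by_cases h : b ∈ B
      · simp [f, h]
      · have : b ≠ 0 := by rintro rfl; exact h (zero_mem _)
        simpa [f, h]
    have hs : ∏ b ∈ S j, f b ∈ B := prod_mem hf
    have hVs : V.valuation (∏ b ∈ S j, f b) = 1 := by
      rw [map_prod]
      refine Finset.prod_eq_one fun b hb ↦ ?_
      refine le_antisymm ((V.valuation_le_one_iff _).mpr (hBV' _ (hf b hb))) ?_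
      by_cases h : b ∈ B
      · simp [f, h]
      · have h1 := (V.valuation_le_one_iff _).mpr (hj b hb)
        have : b ≠ 0 := by rintro rfl; exact h (zero_mem _)
        simp only [f, h, if_false, map_inv₀]
        exact (one_le_inv₀ (by simpa [zero_lt_iff] using this)).mpr h1
    have hunit : ∀ V' : ValuationSubring K, (∀ b ∈ B, b ∈ V') →
        ¬ V'.valuation (∏ b ∈ S j, f b) < 1 → ∀ b ∈ S j, b ∈ V' := by
      intro V' hV' h b hb
      by_contra hbV
      refine h ?_
      have hbB : b ∉ B := fun h ↦ hbV (hV' b h)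
      rw [map_prod, ← Finset.mul_prod_erase _ _ hb]
      refine mul_lt_one_of_lt_of_le ?_ (Finset.prod_le_one' fun c hc ↦
        (V'.valuation_le_one_iff _).mpr (hV' _ (hf c (Finset.mem_of_mem_erase hc))))
      simp only [f, hbB, if_false, map_inv₀]
      rw [← V'.valuation_le_one_iff, not_le] at hbV
      exact inv_lt_one_of_one_lt₀ hbV
    have hsI : (⟨_, hs⟩ : B) ∈ I := by
      rcases hST j with h | h
      · refine (le_sup_left : _ ≤ I) fun V' hV' hT' ↦ ?_
        by_contra hlt
        exact h V' (hk V' hV') (hunit V' hV' hlt) hT'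
      · refine (le_sup_right : _ ≤ I) fun V' hV' hT' ↦ ?_
        by_contra hlt
        exact h V' (hk V' hV') (hunit V' hV' hlt) hT'
    have h1 : ∏ b ∈ S j, f b ∈ V.nonunits := hIV ⟨_, hsI, rfl⟩
    rw [ValuationSubring.mem_nonunits_iff, hVs] at h1
    exact lt_irrefl _ h1
  obtain ⟨a, ha, b, hb, hab⟩ := Submodule.mem_sup.mp ((Ideal.eq_top_iff_one _).mp htop)
  have hcop : IsCoprime a b := ⟨1, 1, by simpa using hab⟩
  obtain ⟨N, c, hc⟩ : ∃ N : ℕ, ∃ c : B, (a * b) ^ N = ⟨t, htB⟩ * c := by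
    by_cases h0 : (a * b).1 = 0
    · exact ⟨1, 0, by rw [pow_one, mul_zero]; exact Subtype.ext h0⟩
    have hz : t⁻¹ ∈ adjoinElem B (a * b).1⁻¹ := by
      set C := adjoinElem B (a * b).1⁻¹ with hC
      let t' : C.toSubring := ⟨t, le_adjoinElem _ _ htB⟩
      suffices h : IsUnit t' by
        obtain ⟨c, hc⟩ := h.exists_right_inv
        have hc' : t * c.1 = 1 := congrArg Subtype.val hc
        rw [← eq_inv_of_mul_eq_one_right hc']
        exact c.2
      rw [← Ideal.span_singleton_eq_top]
      by_contra hne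
      obtain ⟨V, hCV, hIV⟩ := Ideal.image_subset_nonunits_valuationSubring _ hne
      have hV : ∀ b ∈ C, b ∈ V := hCV
      have hBV : ∀ b ∈ B, b ∈ V := fun b hb ↦ hV b (le_adjoinElem _ _ hb)
      have hinv := (V.valuation_le_one_iff _).mpr (hV _ (self_mem_adjoinElem _ _))
      have hge : ¬ V.valuation (a * b).1 < 1 := by
        rw [not_lt]
        rwa [map_inv₀, inv_le_one₀ (by simpa [zero_lt_iff] using h0)] at hinv
      rcases hT V hBV with h | h | h
      · exact hge ((nonunitsIdeal T₁ B).mul_mem_right b ha V hBV h)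
      · exact hge ((nonunitsIdeal T₂ B).mul_mem_left a hb V hBV h)
      · have h1 : t ∈ V.nonunits := hIV ⟨t', Ideal.mem_span_singleton_self _, rfl⟩
        rw [ValuationSubring.mem_nonunits_iff] at h1
        rw [← V.valuation_le_one_iff, map_inv₀,
          inv_le_one₀ (by simpa [zero_lt_iff] using ht)] at h
        exact h.not_gt h1
    obtain ⟨N, hN⟩ := exists_pow_mul_mem_of_mem_adjoinElem_inv (a * b).2 h0 hz
    refine ⟨N, ⟨_, hN⟩, Subtype.ext ?_⟩
    change (a * b).1 ^ N = t * ((a * b).1 ^ N * t⁻¹)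
    field_simp
  intro n
  obtain ⟨α, β, hαβ⟩ := hcop.pow (m := N * n) (n := N * n)
  have hαβ' : α.1 * a.1 ^ (N * n) + β.1 * b.1 ^ (N * n) = 1 := congrArg Subtype.val hαβ
  have hc' : (a.1 * b.1) ^ N = t * c.1 := congrArg Subtype.val hc
  have hcn : a.1 ^ (N * n) * b.1 ^ (N * n) = t ^ n * c.1 ^ n := by
    rw [← mul_pow, pow_mul, hc', mul_pow]
  have hab' : a.1 + b.1 = 1 := congrArg Subtype.val hab
  have htn : t ^ n ≠ 0 := pow_ne_zero _ ht
  refine ⟨β.1 * b.1 ^ (N * n), (β * b ^ (N * n)).2, fun V hV ↦ ⟨fun h1 ↦ ?_, fun h2 ↦ ?_⟩⟩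
  · have h3 := ha V hV h1
    have hb1 : V.valuation b.1 = 1 := by
      rw [show b.1 = 1 - a.1 by linear_combination hab']
      exact V.valuation.map_one_sub_of_lt h3
    have hb0 : b.1 ≠ 0 := by rintro h; simp [h] at hb1
    rw [show (β.1 * b.1 ^ (N * n) - 1) / t ^ n = - (α.1 * c.1 ^ n) * (b.1⁻¹) ^ (N * n) by
      have hbn : b.1 ^ (N * n) ≠ 0 := pow_ne_zero _ hb0
      rw [inv_pow]
      generalize a.1 ^ (N * n) = p at *
      generalize b.1 ^ (N * n) = q at *
      rw [div_eq_iff htn]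
      field_simp
      linear_combination q * hαβ' - α.1 * hcn]
    refine mul_mem (neg_mem (mul_mem (hV _ α.2) (pow_mem (hV _ c.2) _))) (pow_mem ?_ _)
    rw [← V.valuation_le_one_iff, map_inv₀, hb1, inv_one]
  · have h3 := hb V hV h2
    have ha1 : V.valuation a.1 = 1 := by
      rw [show a.1 = 1 - b.1 by linear_combination hab']
      exact V.valuation.map_one_sub_of_lt h3
    have ha0 : a.1 ≠ 0 := by rintro h; simp [h] at ha1
    rw [show (β.1 * b.1 ^ (N * n)) / t ^ n = (β.1 * c.1 ^ n) * (a.1⁻¹) ^ (N * n) by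
      have han : a.1 ^ (N * n) ≠ 0 := pow_ne_zero _ ha0
      rw [inv_pow]
      generalize a.1 ^ (N * n) = p at *
      generalize b.1 ^ (N * n) = q at *
      rw [div_eq_iff htn]
      field_simp
      linear_combination β.1 * hcn]
    refine mul_mem (mul_mem (hV _ β.2) (pow_mem (hV _ c.2) _)) (pow_mem ?_ _)
    rw [← V.valuation_le_one_iff, map_inv₀, ha1, inv_one]

lemma IsAffineModel.exists_separatesWith [CharZero k] {T₁ T₂ : ValuationSubring K → Prop} {t : K}
    (ht : t ≠ 0) {ι : Type*} [Finite ι] (S : ι → Finset K)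
    (hS : ∀ V : ValuationSubring K, (∀ c : k, algebraMap k K c ∈ V) → ∃ j, ∀ b ∈ S j, b ∈ V)
    (hST : ∀ j, (∀ V : ValuationSubring K, (∀ c : k, algebraMap k K c ∈ V) →
        (∀ b ∈ S j, b ∈ V) → ¬ T₁ V) ∨
      (∀ V : ValuationSubring K, (∀ c : k, algebraMap k K c ∈ V) →
        (∀ b ∈ S j, b ∈ V) → ¬ T₂ V))
    {B : Subalgebra k K} (hB : IsAffineModel B) (htB : t ∈ B)
    (hT : ∀ V : ValuationSubring K, (∀ b ∈ B, b ∈ V) → T₁ V ∨ T₂ V ∨ t⁻¹ ∈ V) :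
    ∃ D, D ≠ 0 ∧ SeparatesWith T₁ T₂ t B D := by
  classical
  have := Fintype.ofFinite ι
  refine hB.exists_separatesWith_of_forall ht (Finset.univ.biUnion S).toList htB hT
    fun C hBC _ hC ↦ ⟨1, one_ne_zero, exists_separatesWith_of_mem_or_inv_mem ht S hS hST (hBC htB)
      (fun V hV ↦ hT V fun b hb ↦ hV b (hBC hb)) fun j b hb ↦ hC b ?_⟩
  simpa using ⟨j, hb⟩

end Algebra

section Algebra

variable {k K : Type*} [Field k] [Field K] [Algebra k K]

lemma ValuationSubring.mem_of_monic_of_eval_eq_zero (V : ValuationSubring K) {p : Polynomial K}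
    (hp : p.Monic) (hV : ∀ l, p.coeff l ∈ V) {y : K} (hy : p.eval y = 0) : y ∈ V := by
  have hc : (p.coeffs : Set K) ⊆ V.toSubring := by
    intro c hc
    obtain ⟨l, -, rfl⟩ := Polynomial.mem_coeffs_iff.mp hc
    exact hV l
  refine V.mem_of_isIntegral (R := V) (fun r ↦ r.2) ⟨p.toSubring V.toSubring hc,
    (Polynomial.monic_toSubring _ _ _).mpr hp, ?_⟩
  rw [Polynomial.eval₂_eq_eval_map]
  suffices h : (p.toSubring V.toSubring hc).map (algebraMap V K) = p by rwa [h]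
  ext l
  rw [Polynomial.coeff_map]
  exact Polynomial.coeff_toSubring _ _ hc

/-- `V` has center in the chart `x i ≠ 0` at the hyperplane at infinity of the projective space
with homogeneous coordinates `1, x`. -/
def IsChart (k : Type*) {K ι : Type*} [Field k] [Field K] [Algebra k K] (x : ι → K) (i : ι)
    (V : ValuationSubring K) : Prop :=
  (∀ c : k, algebraMap k K c ∈ V) ∧ (x i)⁻¹ ∈ V ∧ ∀ j, x j / x i ∈ V

variable {ι : Type*} {x : ι → K}

lemma exists_forall_div_pow_mem_of_mem_adjoin (hx0 : ∀ i, x i ≠ 0) {y : K}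
    (hy : y ∈ Algebra.adjoin k (Set.range x)) :
    ∃ M, ∀ m, M ≤ m → ∀ i V, IsChart k x i V → y / x i ^ m ∈ V := by
  induction hy using Algebra.adjoin_induction with
  | mem y hy =>
    obtain ⟨j, rfl⟩ := hy
    refine ⟨1, fun m hm i V hV ↦ ?_⟩
    obtain ⟨m, rfl⟩ := Nat.exists_eq_add_of_le' hm
    convert mul_mem (hV.2.2 j) (pow_mem hV.2.1 m) using 1
    rw [pow_succ, inv_pow]
    field_simp [hx0 i]
  | algebraMap r =>
    refine ⟨0, fun m _ i V hV ↦ ?_⟩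
    rw [div_eq_mul_inv, ← inv_pow]
    exact mul_mem (hV.1 r) (pow_mem hV.2.1 m)
  | add y z _ _ hy hz =>
    obtain ⟨M, hM⟩ := hy
    obtain ⟨N, hN⟩ := hz
    refine ⟨max M N, fun m hm i V hV ↦ ?_⟩
    rw [add_div]
    exact add_mem (hM m (le_of_max_le_left hm) i V hV) (hN m (le_of_max_le_right hm) i V hV)
  | mul y z _ _ hy hz =>
    obtain ⟨M, hM⟩ := hy
    obtain ⟨N, hN⟩ := hz
    refine ⟨M + N, fun m hm i V hV ↦ ?_⟩
    obtain ⟨l, rfl⟩ := Nat.exists_eq_add_of_le hm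
    rw [show M + N + l = M + (N + l) by ring, pow_add, mul_div_mul_comm]
    exact mul_mem (hM _ le_rfl i V hV) (hN _ (Nat.le_add_right _ _) i V hV)

lemma exists_forall_div_pow_mem_of_isIntegral (hx0 : ∀ i, x i ≠ 0) {y : K}
    (hy : IsIntegral (Algebra.adjoin k (Set.range x)) y) :
    ∃ M, ∀ m, M ≤ m → ∀ i V, IsChart k x i V → y / x i ^ m ∈ V := by
  obtain ⟨p, hp, hpy⟩ := hy
  choose M hM using fun l ↦ exists_forall_div_pow_mem_of_mem_adjoin hx0 (p.coeff l).2
  refine ⟨(Finset.range p.natDegree).sup M, fun m hm i V hV ↦ ?_⟩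
  let q := p.map (algebraMap (Algebra.adjoin k (Set.range x)) K)
  have hq : q.Monic := hp.map _
  have hdeg : q.natDegree = p.natDegree := hp.natDegree_map _
  refine V.mem_of_monic_of_eval_eq_zero (p := q.scaleRoots (x i ^ m)⁻¹)
    ((Polynomial.monic_scaleRoots_iff _).mpr hq) (fun l ↦ ?_) ?_
  · rw [Polynomial.coeff_scaleRoots, hdeg]
    rcases lt_trichotomy l p.natDegree with h | h | h
    · obtain ⟨d, hd⟩ := Nat.exists_eq_add_of_lt h
      have h1 : (Finset.range p.natDegree).sup M ≤ m * (d + 1) :=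
        hm.trans (Nat.le_mul_of_pos_right _ d.succ_pos)
      have h2 := hM l (m * (d + 1))
        ((Finset.le_sup (Finset.mem_range.mpr h)).trans h1) i V hV
      rw [show p.natDegree - l = d + 1 by omega, inv_pow, ← pow_mul, ← div_eq_mul_inv]
      simpa [q] using h2
    · rw [h, Nat.sub_self, pow_zero, mul_one, ← hdeg, hq.coeff_natDegree]
      exact one_mem _
    · rw [Polynomial.coeff_eq_zero_of_natDegree_lt (hdeg.trans_lt h), zero_mul]
      exact zero_mem _
  · rw [div_eq_inv_mul, ← Polynomial.eval₂_id]
    refine Polynomial.scaleRoots_eval₂_eq_zero (RingHom.id K) ?_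
    rw [Polynomial.eval₂_id, Polynomial.eval_map]
    exact hpy

lemma IsAffineModel.exists_chart [Finite ι] {A : Subalgebra k K} (hA : IsAffineModel A)
    (hx0 : ∀ i, x i ≠ 0) (hxA : ∀ i, x i ∈ A)
    (hint : ∀ a ∈ A, IsIntegral (Algebra.adjoin k (Set.range x)) a) (i : ι) :
    ∃ S : Subalgebra k K, IsAffineModel S ∧
      (∀ V : ValuationSubring K, (∀ b ∈ S, b ∈ V) ↔ IsChart k x i V) ∧ (x i)⁻¹ ∈ S ∧
      ∀ y ∈ S, ∃ m : ℕ, x i ^ m * y ∈ A := by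
  classical
  have := Fintype.ofFinite ι
  obtain ⟨⟨s, hs⟩, hfrac⟩ := hA
  have hsA : ∀ a ∈ s, a ∈ A := fun a ha ↦ hs ▸ Algebra.subset_adjoin ha
  have hM : ∀ a : K, ∃ M : ℕ, a ∈ s → ∀ m, M ≤ m → ∀ i V, IsChart k x i V → a / x i ^ m ∈ V := by
    intro a
    by_cases ha : a ∈ s
    · obtain ⟨M, hM⟩ := exists_forall_div_pow_mem_of_isIntegral hx0 (hint a (hsA a ha))
      exact ⟨M, fun _ ↦ hM⟩
    · exact ⟨0, fun h ↦ absurd h ha⟩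
  choose M hM using hM
  let N := s.sup M
  let g : Finset K := {(x i)⁻¹} ∪ Finset.univ.image (fun j ↦ x j / x i) ∪
    s.image (fun a ↦ a / x i ^ N)
  let S := Algebra.adjoin k (g : Set K)
  have hinv : (x i)⁻¹ ∈ S := Algebra.subset_adjoin (by simp [g])
  have hAS : ∀ a ∈ A, ∃ m : ℕ, a / x i ^ m ∈ S := by
    intro a ha
    rw [← hs] at ha
    induction ha using Algebra.adjoin_induction with
    | mem a ha =>
      refine ⟨N, Algebra.subset_adjoin ?_⟩
      simp only [g, Finset.coe_union, Finset.coe_image]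
      exact Or.inr ⟨a, ha, rfl⟩
    | algebraMap r => exact ⟨0, by simp⟩
    | add y z _ _ hy hz =>
      obtain ⟨m, hm⟩ := hy
      obtain ⟨m', hm'⟩ := hz
      refine ⟨m + m', ?_⟩
      convert add_mem (mul_mem hm (pow_mem hinv m')) (mul_mem hm' (pow_mem hinv m)) using 1
      have := hx0 i
      rw [inv_pow, inv_pow]
      field_simp
      ring
    | mul y z _ _ hy hz =>
      obtain ⟨m, hm⟩ := hy
      obtain ⟨m', hm'⟩ := hz
      refine ⟨m + m', ?_⟩
      rw [pow_add, mul_div_mul_comm]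
      exact mul_mem hm hm'
  refine ⟨S, ⟨⟨g, rfl⟩, fun y ↦ ?_⟩, fun V ↦ ⟨fun hV ↦ ⟨fun c ↦ hV _ (S.algebraMap_mem c),
    hV _ hinv, fun j ↦ hV _ (Algebra.subset_adjoin (by simp [g]))⟩, fun hV ↦ ?_⟩, hinv,
    fun y hy ↦ ?_⟩
  · obtain ⟨a, ha, b, hb, hb0, rfl⟩ := hfrac y
    obtain ⟨m, hm⟩ := hAS a ha
    obtain ⟨m', hm'⟩ := hAS b hb
    refine ⟨_, mul_mem hm (pow_mem hinv m'), _, mul_mem hm' (pow_mem hinv m), ?_, ?_⟩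
    · have := hx0 i
      exact mul_ne_zero (div_ne_zero hb0 (pow_ne_zero _ this)) (pow_ne_zero _ (inv_ne_zero this))
    · have := hx0 i
      rw [inv_pow, inv_pow]
      field_simp
  · refine mem_valuationSubring_of_mem_adjoin hV.1 fun b hb ↦ ?_
    simp only [g, Finset.coe_union, Finset.coe_image, Finset.coe_singleton, Finset.coe_univ,
      Set.image_univ] at hb
    rcases hb with (rfl | ⟨j, rfl⟩) | ⟨a, ha, rfl⟩
    · exact hV.2.1
    · exact hV.2.2 j
    · exact hM a ha N (Finset.le_sup (f := M) ha) i V hV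
  · induction hy using Algebra.adjoin_induction with
    | mem b hb =>
      simp only [g, Finset.coe_union, Finset.coe_image, Finset.coe_singleton, Finset.coe_univ,
        Set.image_univ] at hb
      rcases hb with (rfl | ⟨j, rfl⟩) | ⟨a, ha, rfl⟩
      · exact ⟨1, by simp [hx0 i]⟩
      · exact ⟨1, by simpa [mul_div_cancel₀ _ (hx0 i)] using hxA j⟩
      · exact ⟨N, by simpa [mul_div_cancel₀ _ (pow_ne_zero N (hx0 i))] using hsA a ha⟩
    | algebraMap r => exact ⟨0, by simp⟩
    | add y z _ _ hy hz =>
      obtain ⟨m, hm⟩ := hy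
      obtain ⟨m', hm'⟩ := hz
      refine ⟨m + m', ?_⟩
      convert add_mem (mul_mem hm (pow_mem (hxA i) m')) (mul_mem hm' (pow_mem (hxA i) m)) using 1
      ring
    | mul y z _ _ hy hz =>
      obtain ⟨m, hm⟩ := hy
      obtain ⟨m', hm'⟩ := hz
      refine ⟨m + m', ?_⟩
      convert mul_mem hm hm' using 1
      ring

lemma IsAffineModel.exists_separating [CharZero k] [Finite ι] {A : Subalgebra k K}
    (hA : IsAffineModel A) (hx0 : ∀ i, x i ≠ 0) (hxA : ∀ i, x i ∈ A)
    (hint : ∀ a ∈ A, IsIntegral (Algebra.adjoin k (Set.range x)) a)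
    {T₁ T₂ : ValuationSubring K → Prop} {κ : Type*} [Finite κ] (S : κ → Finset K)
    (hS : ∀ V : ValuationSubring K, (∀ c : k, algebraMap k K c ∈ V) → ∃ j, ∀ b ∈ S j, b ∈ V)
    (hST : ∀ j, (∀ V : ValuationSubring K, (∀ c : k, algebraMap k K c ∈ V) →
        (∀ b ∈ S j, b ∈ V) → ¬ T₁ V) ∨
      (∀ V : ValuationSubring K, (∀ c : k, algebraMap k K c ∈ V) →
        (∀ b ∈ S j, b ∈ V) → ¬ T₂ V))
    (hT : ∀ V : ValuationSubring K, (∀ c : k, algebraMap k K c ∈ V) →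
      T₁ V ∨ T₂ V ∨ ∀ a ∈ A, a ∈ V) :
    ∃ q ∈ A, q ≠ 0 ∧ ∀ i, ∀ n : ℕ, ∃ G : K, (∃ m : ℕ, x i ^ m * G ∈ A) ∧
      ∀ V, IsChart k x i V → (T₁ V → (G - q) * x i ^ n ∈ V) ∧ (T₂ V → G * x i ^ n ∈ V) := by
  classical
  have := Fintype.ofFinite ι
  choose U hU hUV hxU hUA using hA.exists_chart hx0 hxA hint
  have hsep : ∀ i, ∃ D ∈ U i, D ≠ 0 ∧ SeparatesWith T₁ T₂ (x i)⁻¹ (U i) D := by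
    intro i
    obtain ⟨D, hD0, hD⟩ := (hU i).exists_separatesWith (inv_ne_zero (hx0 i)) S hS hST (hxU i)
      fun V hV ↦ (hT V ((hUV i V).mp hV).1).imp_right (Or.imp_right fun h ↦ by
        rw [inv_inv]; exact h _ (hxA i))
    exact (hU i).exists_separatesWith_mem le_rfl hD0 hD
  choose D hDU hD0 hD using hsep
  choose N hN using fun i ↦ hUA i (D i) (hDU i)
  refine ⟨∏ i, x i ^ N i * D i, prod_mem fun i _ ↦ hN i, Finset.prod_ne_zero_iff.mpr fun i _ ↦
    mul_ne_zero (pow_ne_zero _ (hx0 i)) (hD0 i), fun i n ↦ ?_⟩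
  let r := ∏ j ∈ Finset.univ.erase i, x j ^ N j * D j
  have hr : r ∈ A := prod_mem fun j _ ↦ hN j
  have hq : ∏ i, x i ^ N i * D i = x i ^ N i * D i * r :=
    (Finset.mul_prod_erase _ _ (Finset.mem_univ i)).symm
  obtain ⟨M, hM⟩ := exists_forall_div_pow_mem_of_isIntegral hx0 (hint r hr)
  obtain ⟨g, hg, hgV⟩ := hD i (n + N i + M)
  obtain ⟨m, hm⟩ := hUA i g hg
  refine ⟨g * x i ^ N i * r, ⟨m, ?_⟩, fun V hV ↦ ?_⟩
  · rw [← mul_assoc, ← mul_assoc]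
    exact mul_mem (mul_mem hm (pow_mem (hxA i) _)) hr
  · have hr' := hM M le_rfl i V hV
    have hxi := hx0 i
    obtain ⟨h1, h2⟩ := hgV V ((hUV i V).mpr hV)
    refine ⟨fun h ↦ ?_, fun h ↦ ?_⟩
    · convert mul_mem (h1 h) hr' using 1
      rw [hq, inv_pow]
      field_simp
      ring
    · convert mul_mem (h2 h) hr' using 1
      rw [inv_pow]
      field_simp
      ring

end Algebra

section Algebra

open MvPolynomial in
/-- If two Laurent polynomials `f / X₀ ^ m` and `g / X₁ ^ m` agree to high order at infinity, then
the first one is a polynomial plus a term that is small at infinity. -/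
lemma MvPolynomial.exists_totalDegree_sub_add_le {σ R : Type*} [CommRing R] {i j : σ} (hij : i ≠ j)
    {f g : MvPolynomial σ R} {m n : ℕ}
    (h : (X j ^ m * f - X i ^ m * g).totalDegree + n ≤ 2 * m) (hnm : n ≤ m) :
    ∃ p : MvPolynomial σ R, (f - X i ^ m * p).totalDegree + n ≤ m := by
  classical
  refine ⟨f.divMonomial (Finsupp.single i m), ?_⟩
  have hf := f.divMonomial_add_modMonomial (Finsupp.single i m)
  have hr : f - X i ^ m * f.divMonomial (Finsupp.single i m) =
      f.modMonomial (Finsupp.single i m) := by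
    rw [X_pow_eq_monomial]
    exact sub_eq_of_eq_add' hf.symm
  rw [hr]
  refine (Nat.le_sub_iff_add_le hnm).mp (Finset.sup_le fun s hs ↦ ?_)
  rw [mem_support_iff] at hs
  have hsi : ¬ Finsupp.single i m ≤ s := fun hle ↦ hs (coeff_modMonomial_of_le _ hle)
  rw [coeff_modMonomial_of_not_le _ hsi] at hs
  have hco : (X j ^ m * f - X i ^ m * g).coeff (Finsupp.single j m + s) = f.coeff s := by
    rw [coeff_sub, X_pow_eq_monomial, X_pow_eq_monomial, coeff_monomial_mul, one_mul,
      coeff_monomial_mul', if_neg, sub_zero]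
    intro hle
    refine hsi fun a ↦ ?_
    by_cases ha : a = i
    · subst ha
      simpa [Finsupp.single_apply, hij.symm] using hle a
    · simp [Ne.symm ha]
  have hmem : Finsupp.single j m + s ∈ (X j ^ m * f - X i ^ m * g).support := by
    rwa [mem_support_iff, hco]
  have h1 := le_totalDegree hmem
  rw [Finsupp.sum_add_index' (by simp) (by simp), Finsupp.sum_single_index rfl] at h1
  omega

variable {σ k L : Type*} [Field k] [Field L] [Algebra (MvPolynomial σ k) L]
  [IsFractionRing (MvPolynomial σ k) L]

variable (σ k L) in
/-- The valuation ring of the rational functions of degree at most zero. -/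
def degreeValuationSubring : ValuationSubring L where
  carrier := {z | ∃ f g : MvPolynomial σ k, g ≠ 0 ∧ f.totalDegree ≤ g.totalDegree ∧
    z = algebraMap _ L f / algebraMap _ L g}
  mul_mem' := by
    rintro _ _ ⟨f, g, hg, hfg, rfl⟩ ⟨f', g', hg', hfg', rfl⟩
    refine ⟨f * f', g * g', mul_ne_zero hg hg', ?_, by rw [map_mul, map_mul, div_mul_div_comm]⟩
    rw [MvPolynomial.totalDegree_mul_of_isDomain hg hg']
    exact (MvPolynomial.totalDegree_mul _ _).trans (add_le_add hfg hfg')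
  one_mem' := ⟨1, 1, one_ne_zero, le_rfl, by simp⟩
  add_mem' := by
    rintro _ _ ⟨f, g, hg, hfg, rfl⟩ ⟨f', g', hg', hfg', rfl⟩
    have hgL := IsFractionRing.to_map_eq_zero_iff (K := L) (x := g) |>.not.mpr hg
    have hgL' := IsFractionRing.to_map_eq_zero_iff (K := L) (x := g') |>.not.mpr hg'
    refine ⟨f * g' + g * f', g * g', mul_ne_zero hg hg', ?_, by
      rw [map_add, map_mul, map_mul, map_mul, div_add_div _ _ hgL hgL']⟩
    rw [MvPolynomial.totalDegree_mul_of_isDomain hg hg']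
    refine (MvPolynomial.totalDegree_add _ _).trans (max_le ?_ ?_)
    · exact (MvPolynomial.totalDegree_mul _ _).trans (add_le_add_left hfg _)
    · exact (MvPolynomial.totalDegree_mul _ _).trans (add_le_add_right hfg' _)
  zero_mem' := ⟨0, 1, one_ne_zero, by simp, by simp⟩
  neg_mem' := by
    rintro _ ⟨f, g, hg, hfg, rfl⟩
    exact ⟨-f, g, hg, by rwa [MvPolynomial.totalDegree_neg], by rw [map_neg, neg_div]⟩
  mem_or_inv_mem' z := by
    obtain ⟨f, g, hg, rfl⟩ := IsFractionRing.div_surjective (A := MvPolynomial σ k) z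
    rw [mem_nonZeroDivisors_iff_ne_zero] at hg
    rcases le_total f.totalDegree g.totalDegree with h | h
    · exact Or.inl ⟨f, g, hg, h, rfl⟩
    · by_cases hf : f = 0
      · exact Or.inl ⟨f, g, hg, by simp [hf], rfl⟩
      · exact Or.inr ⟨g, f, hf, h, by rw [inv_div]⟩

lemma div_mem_degreeValuationSubring_iff {f g : MvPolynomial σ k} (hg : g ≠ 0) :
    algebraMap _ L f / algebraMap _ L g ∈ degreeValuationSubring σ k L ↔
      f.totalDegree ≤ g.totalDegree := by
  refine ⟨?_, fun h ↦ ⟨f, g, hg, h, rfl⟩⟩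
  rintro ⟨f', g', hg', h, heq⟩
  have hgL := IsFractionRing.to_map_eq_zero_iff (K := L) (x := g) |>.not.mpr hg
  have hgL' := IsFractionRing.to_map_eq_zero_iff (K := L) (x := g') |>.not.mpr hg'
  rw [div_eq_div_iff hgL hgL', ← map_mul, ← map_mul] at heq
  have heq := IsFractionRing.injective (MvPolynomial σ k) L heq
  by_cases hf : f = 0
  · simp [hf]
  have hf' : f' ≠ 0 := by
    rintro rfl
    rw [zero_mul] at heq
    exact mul_ne_zero hf hg' heq
  have := congrArg MvPolynomial.totalDegree heq
  rw [MvPolynomial.totalDegree_mul_of_isDomain hf hg',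
    MvPolynomial.totalDegree_mul_of_isDomain hf' hg] at this
  omega

/-- The rational function `y` has poles only along `X i = 0`. -/
def IsLaurentAt (k : Type*) {σ L : Type*} [Field k] [Field L] [Algebra (MvPolynomial σ k) L]
    (i : σ) (y : L) : Prop :=
  ∃ (m : ℕ) (f : MvPolynomial σ k),
    algebraMap _ L (MvPolynomial.X i : MvPolynomial σ k) ^ m * y = algebraMap _ L f

lemma algebraMap_X_ne_zero (i : σ) : algebraMap _ L (MvPolynomial.X i : MvPolynomial σ k) ≠ 0 :=
  IsFractionRing.to_map_eq_zero_iff (K := L) |>.not.mpr (MvPolynomial.X_ne_zero i)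

lemma IsLaurentAt.exists_eq_div {i : σ} {y : L} (h : IsLaurentAt k i y) :
    ∃ m₀, ∀ m, m₀ ≤ m → ∃ f : MvPolynomial σ k,
      y = algebraMap _ L f / algebraMap _ L (MvPolynomial.X i ^ m : MvPolynomial σ k) := by
  obtain ⟨m₀, f, hf⟩ := h
  refine ⟨m₀, fun m hm ↦ ?_⟩
  obtain ⟨l, rfl⟩ := Nat.exists_eq_add_of_le' hm
  refine ⟨MvPolynomial.X i ^ l * f, ?_⟩
  have := algebraMap_X_ne_zero (k := k) (L := L) i
  rw [map_mul, ← hf, map_pow, map_pow]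
  field_simp
  ring

lemma mul_X_pow_mem_degreeValuationSubring_iff {i : σ} {f : MvPolynomial σ k} {m n : ℕ}
    (hnm : n ≤ m) :
    algebraMap _ L f / algebraMap _ L (MvPolynomial.X i ^ m : MvPolynomial σ k) *
      algebraMap _ L (MvPolynomial.X i : MvPolynomial σ k) ^ n ∈ degreeValuationSubring σ k L ↔
      f.totalDegree + n ≤ m := by
  obtain ⟨l, rfl⟩ := Nat.exists_eq_add_of_le' hnm
  have := algebraMap_X_ne_zero (k := k) (L := L) i
  rw [show algebraMap _ L f / algebraMap _ L (MvPolynomial.X i ^ (l + n) : MvPolynomial σ k) *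
      algebraMap _ L (MvPolynomial.X i : MvPolynomial σ k) ^ n =
      algebraMap _ L f / algebraMap _ L (MvPolynomial.X i ^ l : MvPolynomial σ k) by
    rw [map_pow, map_pow, pow_add]; field_simp,
    div_mem_degreeValuationSubring_iff (pow_ne_zero _ (MvPolynomial.X_ne_zero i)),
    MvPolynomial.totalDegree_X_pow]
  omega

lemma IsLaurentAt.exists_sub_mul_pow_mem {i j : σ} (hij : i ≠ j) {y z : L}
    (hy : IsLaurentAt k i y) (hz : IsLaurentAt k j z) {n : ℕ}
    (h : (y - z) * algebraMap _ L (MvPolynomial.X i : MvPolynomial σ k) ^ n ∈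
      degreeValuationSubring σ k L) :
    ∃ p : MvPolynomial σ k, (y - algebraMap _ L p) *
      algebraMap _ L (MvPolynomial.X i : MvPolynomial σ k) ^ n ∈ degreeValuationSubring σ k L := by
  obtain ⟨m₁, hm₁⟩ := hy.exists_eq_div
  obtain ⟨m₂, hm₂⟩ := hz.exists_eq_div
  obtain ⟨f, rfl⟩ := hm₁ (m₁ + m₂ + n) (by omega)
  obtain ⟨g, rfl⟩ := hm₂ (m₁ + m₂ + n) (by omega)
  generalize hm : m₁ + m₂ + n = m at h
  have hnm : n ≤ m := by omega
  have hi := algebraMap_X_ne_zero (k := k) (L := L) i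
  have hj := algebraMap_X_ne_zero (k := k) (L := L) j
  have hXi : (MvPolynomial.X i : MvPolynomial σ k) ≠ 0 := MvPolynomial.X_ne_zero i
  have hXj : (MvPolynomial.X j : MvPolynomial σ k) ≠ 0 := MvPolynomial.X_ne_zero j
  have hdeg : (MvPolynomial.X j ^ m * f - MvPolynomial.X i ^ m * g).totalDegree + n ≤ 2 * m := by
    have h1 : (MvPolynomial.X j ^ m * f - MvPolynomial.X i ^ m * g).totalDegree ≤
        (MvPolynomial.X i ^ (m - n) * MvPolynomial.X j ^ m : MvPolynomial σ k).totalDegree := by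
      rw [← div_mem_degreeValuationSubring_iff (L := L)
        (mul_ne_zero (pow_ne_zero _ hXi) (pow_ne_zero _ hXj))]
      convert h using 1
      obtain ⟨l, rfl⟩ := Nat.exists_eq_add_of_le' hnm
      simp only [map_sub, map_mul, map_pow, Nat.add_sub_cancel]
      field_simp
      ring
    rw [MvPolynomial.totalDegree_mul_of_isDomain (pow_ne_zero _ hXi) (pow_ne_zero _ hXj),
      MvPolynomial.totalDegree_X_pow, MvPolynomial.totalDegree_X_pow] at h1
    omega
  obtain ⟨p, hp⟩ := MvPolynomial.exists_totalDegree_sub_add_le hij hdeg hnm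
  refine ⟨p, ?_⟩
  rw [hm, ← mul_X_pow_mem_degreeValuationSubring_iff (L := L) (i := i) hnm] at *
  convert hp using 2
  simp only [map_sub, map_mul, map_pow]
  field_simp

lemma eq_zero_of_mul_X_mem_degreeValuationSubring {i : σ} {p : MvPolynomial σ k}
    (h : algebraMap _ L p * algebraMap _ L (MvPolynomial.X i : MvPolynomial σ k) ∈
      degreeValuationSubring σ k L) : p = 0 := by
  by_contra hp
  have h1 : algebraMap _ L (p * MvPolynomial.X i) / algebraMap _ L (1 : MvPolynomial σ k) ∈
      degreeValuationSubring σ k L := by simpa using h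
  rw [div_mem_degreeValuationSubring_iff one_ne_zero,
    MvPolynomial.totalDegree_mul_of_isDomain hp (MvPolynomial.X_ne_zero i)] at h1
  simp at h1

end Algebra

section Algebra

variable {σ k L : Type*} [Field k] [Field L] [Algebra (MvPolynomial σ k) L]
  [IsFractionRing (MvPolynomial σ k) L]

lemma div_X_mem_degreeValuationSubring (i j : σ) :
    algebraMap _ L (MvPolynomial.X i : MvPolynomial σ k) /
      algebraMap _ L (MvPolynomial.X j : MvPolynomial σ k) ∈ degreeValuationSubring σ k L := by
  rw [div_mem_degreeValuationSubring_iff (MvPolynomial.X_ne_zero j)]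
  simp

lemma inv_X_mem_degreeValuationSubring (i : σ) :
    (algebraMap _ L (MvPolynomial.X i : MvPolynomial σ k))⁻¹ ∈ degreeValuationSubring σ k L := by
  rw [← one_div, ← map_one (algebraMap (MvPolynomial σ k) L),
    div_mem_degreeValuationSubring_iff (MvPolynomial.X_ne_zero i)]
  simp

/-- A family of functions with poles along the coordinate hyperplanes which agree to higher and
higher order at infinity is approximated by a single polynomial. -/
lemma exists_polynomial_forall_sub_mul_pow_mem [Nontrivial σ] (i₀ : σ) (t : σ → ℕ → L)
    (ht : ∀ i n, IsLaurentAt k i (t i n))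
    (h : ∀ i j n n', n ≤ n' → (t i n - t j n') *
      algebraMap _ L (MvPolynomial.X i₀ : MvPolynomial σ k) ^ n ∈ degreeValuationSubring σ k L) :
    ∃ p : MvPolynomial σ k, ∀ i n, 1 ≤ n → (t i n - algebraMap _ L p) *
      algebraMap _ L (MvPolynomial.X i₀ : MvPolynomial σ k) ^ n ∈ degreeValuationSubring σ k L := by
  obtain ⟨i₁, hi₁⟩ := exists_ne i₀
  choose p hp using fun n ↦ (ht i₀ n).exists_sub_mul_pow_mem hi₁.symm (ht i₁ n)
    (h i₀ i₁ n n le_rfl)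
  have hX := algebraMap_X_ne_zero (k := k) (L := L) i₀
  have hdown : ∀ n, 1 ≤ n → ∀ z : L,
      z * algebraMap _ L (MvPolynomial.X i₀ : MvPolynomial σ k) ^ n ∈ degreeValuationSubring σ k L →
      z * algebraMap _ L (MvPolynomial.X i₀ : MvPolynomial σ k) ∈
        degreeValuationSubring σ k L := by
    intro n hn z hz
    obtain ⟨n, rfl⟩ := Nat.exists_eq_add_of_le' hn
    convert mul_mem hz (pow_mem (inv_X_mem_degreeValuationSubring (k := k) (L := L) i₀) n) using 1
    rw [inv_pow, pow_succ]
    field_simp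
  have hpp : ∀ n, 1 ≤ n → p n = p 1 := by
    intro n hn
    rw [← sub_eq_zero]
    refine eq_zero_of_mul_X_mem_degreeValuationSubring (L := L) (i := i₀) ?_
    have h1 := hdown n hn _ (hp n)
    have h2 := hdown 1 le_rfl _ (hp 1)
    have h3 := hdown 1 le_rfl _ (h i₀ i₀ 1 n hn)
    convert sub_mem (sub_mem h2 h1) h3 using 1
    rw [map_sub]
    ring
  refine ⟨p 1, fun i n hn ↦ ?_⟩
  rw [← hpp n hn]
  convert add_mem (hp n) (h i i₀ n n le_rfl) using 1
  ring

variable {K : Type*} [Field K] [Algebra k K] [Algebra (MvPolynomial σ k) K] [Algebra L K]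
  [IsScalarTower k (MvPolynomial σ k) K] [IsScalarTower (MvPolynomial σ k) L K]

lemma isIntegral_adjoin_of_isIntegral {y : K} (hy : IsIntegral (MvPolynomial σ k) y) :
    IsIntegral (Algebra.adjoin k (Set.range fun i : σ ↦
      algebraMap (MvPolynomial σ k) K (MvPolynomial.X i))) y := by
  set A := Algebra.adjoin k (Set.range fun i : σ ↦
    algebraMap (MvPolynomial σ k) K (MvPolynomial.X i))
  have hA : ∀ f : MvPolynomial σ k, algebraMap _ K f ∈ A := by
    intro f
    induction f using MvPolynomial.induction_on with
    | C a =>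
      rw [← MvPolynomial.algebraMap_eq, ← IsScalarTower.algebraMap_apply]
      exact A.algebraMap_mem a
    | add p q hp hq => rw [map_add]; exact add_mem hp hq
    | mul_X p i hp =>
      rw [map_mul]
      exact mul_mem hp (Algebra.subset_adjoin ⟨i, rfl⟩)
  obtain ⟨p, hp, hpy⟩ := hy
  refine ⟨p.map ((algebraMap (MvPolynomial σ k) K).codRestrict A hA), hp.map _, ?_⟩
  rw [Polynomial.eval₂_map]
  exact hpy

lemma algebraMap_div_pow_mem_of_isChart {i : σ}
    {V : ValuationSubring K}
    (hV : IsChart k (fun i : σ ↦ algebraMap (MvPolynomial σ k) K (MvPolynomial.X i)) i V)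
    (hi : algebraMap (MvPolynomial σ k) K (MvPolynomial.X i) ≠ 0)
    {f : MvPolynomial σ k} {m : ℕ} (hm : f.totalDegree ≤ m) :
    algebraMap _ K f / algebraMap (MvPolynomial σ k) K (MvPolynomial.X i) ^ m ∈ V := by
  classical
  conv => enter [2, 1, 2]; rw [f.as_sum]
  rw [map_sum, Finset.sum_div]
  refine sum_mem fun s hs ↦ ?_
  have hsm : (s.sum fun _ e ↦ e) ≤ m := (MvPolynomial.le_totalDegree hs).trans hm
  obtain ⟨d, hd⟩ := Nat.exists_eq_add_of_le hsm
  have hprod : ∏ j ∈ s.support, (algebraMap (MvPolynomial σ k) K (MvPolynomial.X j) /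
      algebraMap (MvPolynomial σ k) K (MvPolynomial.X i)) ^ s j ∈ V :=
    prod_mem fun j _ ↦ pow_mem (hV.2.2 j) _
  convert mul_mem (mul_mem (hV.1 (f.coeff s)) hprod) (pow_mem hV.2.1 d) using 1
  rw [MvPolynomial.monomial_eq, map_mul, ← MvPolynomial.algebraMap_eq,
    ← IsScalarTower.algebraMap_apply, Finsupp.prod, map_prod, hd, pow_add, Finsupp.sum,
    ← Finset.prod_pow_eq_pow_sum]
  simp only [map_pow, div_pow, Finset.prod_div_distrib, inv_pow]
  have hprod0 : ∏ j ∈ s.support, algebraMap (MvPolynomial σ k) K (MvPolynomial.X i) ^ s j ≠ 0 :=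
    Finset.prod_ne_zero_iff.mpr fun j _ ↦ pow_ne_zero _ hi
  field_simp

lemma IsLaurentAt.algebraMap_mul_pow_mem {i i₀ : σ} {y : L} (hy : IsLaurentAt k i y) {n : ℕ}
    (h : y * algebraMap _ L (MvPolynomial.X i₀ : MvPolynomial σ k) ^ n ∈
      degreeValuationSubring σ k L) {V : ValuationSubring K}
    (hV : IsChart k (fun i : σ ↦ algebraMap (MvPolynomial σ k) K (MvPolynomial.X i)) i V) :
    algebraMap L K y * algebraMap (MvPolynomial σ k) K (MvPolynomial.X i) ^ n ∈ V := by
  have h₀ := algebraMap_X_ne_zero (k := k) (L := L) i₀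
  have hi := algebraMap_X_ne_zero (k := k) (L := L) i
  obtain ⟨m₀, hm₀⟩ := hy.exists_eq_div
  obtain ⟨f, hf⟩ := hm₀ (m₀ + n) (by omega)
  have h1 : y * algebraMap _ L (MvPolynomial.X i : MvPolynomial σ k) ^ n ∈
      degreeValuationSubring σ k L := by
    convert mul_mem h (pow_mem (div_X_mem_degreeValuationSubring (k := k) (L := L) i i₀) n) using 1
    rw [div_pow]
    field_simp
  rw [hf, mul_X_pow_mem_degreeValuationSubring_iff (by omega)] at h1
  have hiK : algebraMap (MvPolynomial σ k) K (MvPolynomial.X i) ≠ 0 := by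
    rw [IsScalarTower.algebraMap_apply _ L K]
    exact (map_ne_zero _).mpr hi
  convert algebraMap_div_pow_mem_of_isChart hV hiK (m := m₀) (f := f) (by omega) using 1
  rw [hf, map_div₀, ← IsScalarTower.algebraMap_apply, ← IsScalarTower.algebraMap_apply, map_pow,
    pow_add]
  field_simp

variable [FiniteDimensional L K]

lemma trace_mem_of_forall_mem (O : ValuationSubring L) {z : K}
    (h : ∀ V : ValuationSubring K, (∀ y ∈ O, algebraMap L K y ∈ V) → z ∈ V) :
    Algebra.trace L K z ∈ O := by
  let : Algebra O K := ((algebraMap L K).comp O.subtype).toAlgebra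
  have : IsScalarTower O L K := IsScalarTower.of_algebraMap_eq' rfl
  have h1 : z ∈ ⨅ V : {V : ValuationSubring K // (algebraMap L K '' O) ⊆ V.toSubring},
      V.1.toSubring := by
    rw [Subring.mem_iInf]
    exact fun V ↦ h V.1 fun y hy ↦ V.2 ⟨y, hy, rfl⟩
  rw [iInf_valuationSubring_superset] at h1
  have h2 : Subring.closure (algebraMap L K '' O) = O.toSubring.map (algebraMap L K) :=
    Subring.closure_eq (O.toSubring.map (algebraMap L K))
  rw [h2] at h1
  have hz : IsIntegral O z := by
    obtain ⟨p, hp, hpz⟩ := h1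
    have hlift : p ∈ Polynomial.lifts
        ((algebraMap L K).restrict O.toSubring (O.toSubring.map (algebraMap L K))
          fun y hy ↦ ⟨y, hy, rfl⟩) := by
      rw [Polynomial.lifts_iff_coeff_lifts]
      rintro l
      obtain ⟨y, hy, hyl⟩ := (p.coeff l).2
      exact ⟨⟨y, hy⟩, Subtype.ext hyl⟩
    obtain ⟨q, hq, -, hqm⟩ := Polynomial.lifts_and_degree_eq_and_monic hlift hp
    refine ⟨q, hqm, ?_⟩
    rw [← hq, Polynomial.eval₂_map] at hpz
    exact hpz
  obtain ⟨y, hy⟩ := IsIntegrallyClosed.isIntegral_iff.mp (Algebra.isIntegral_trace (L := L) hz)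
  rw [← hy]
  exact y.2

end Algebra

section Algebra

variable {σ k L : Type*} [Field k] [Field L] [Algebra (MvPolynomial σ k) L]

lemma IsLaurentAt.sub_algebraMap {i : σ} {y : L} (h : IsLaurentAt k i y) (p : MvPolynomial σ k) :
    IsLaurentAt k i (y - algebraMap _ L p) := by
  obtain ⟨m, f, hf⟩ := h
  exact ⟨m, f - MvPolynomial.X i ^ m * p, by rw [mul_sub, hf, map_sub, map_mul, map_pow]⟩

variable [IsFractionRing (MvPolynomial σ k) L]
variable {K : Type*} [Field K] [Algebra (MvPolynomial σ k) K] [Algebra L K]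
  [IsScalarTower (MvPolynomial σ k) L K]
  [FiniteDimensional L K]

lemma isLaurentAt_trace_of_isIntegral {i : σ} {y : K} {m : ℕ}
    (h : IsIntegral (MvPolynomial σ k)
      (algebraMap (MvPolynomial σ k) K (MvPolynomial.X i) ^ m * y)) :
    IsLaurentAt k i (Algebra.trace L K y) := by
  have h1 := Algebra.isIntegral_trace (L := L) h
  obtain ⟨f, hf⟩ := IsIntegrallyClosed.isIntegral_iff.mp h1
  refine ⟨m, f, ?_⟩
  have h2 : algebraMap (MvPolynomial σ k) K (MvPolynomial.X i) ^ m * y =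
      (algebraMap (MvPolynomial σ k) L (MvPolynomial.X i) ^ m) • y := by
    rw [Algebra.smul_def, map_pow, ← IsScalarTower.algebraMap_apply]
  rw [hf, h2, map_smul, smul_eq_mul]

/-- A family of functions on the charts at infinity, agreeing to higher and higher order along the
hyperplane at infinity, is up to a denominator approximated by one rational function. -/
lemma exists_forall_mul_sub_mul_pow_mem {σ k : Type*} [Field k] [CharZero k] [Nontrivial σ]
    (L : Type*) [Field L] [Algebra (MvPolynomial σ k) L] [IsFractionRing (MvPolynomial σ k) L]
    {K : Type*} [Field K] [Algebra k K] [Algebra (MvPolynomial σ k) K] [Algebra L K]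
    [IsScalarTower k (MvPolynomial σ k) K] [IsScalarTower (MvPolynomial σ k) L K]
    [FiniteDimensional L K] (G : σ → ℕ → K)
    (hG : ∀ i n, ∃ m : ℕ, IsIntegral (MvPolynomial σ k)
      (algebraMap (MvPolynomial σ k) K (MvPolynomial.X i) ^ m * G i n))
    (hGV : ∀ V : ValuationSubring K,
      (∀ i, IsChart k (fun i : σ ↦ algebraMap (MvPolynomial σ k) K (MvPolynomial.X i)) i V) →
      ∀ i j n n', n ≤ n' → ∀ i₀,
        (G i n - G j n') * algebraMap (MvPolynomial σ k) K (MvPolynomial.X i₀) ^ n ∈ V) :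
    ∃ (c : K) (H : K) (M : ℕ), c ≠ 0 ∧ IsIntegral (MvPolynomial σ k) c ∧ ∀ i n V,
      IsChart k (fun i : σ ↦ algebraMap (MvPolynomial σ k) K (MvPolynomial.X i)) i V →
      c * (G i (n + M) - H) * algebraMap (MvPolynomial σ k) K (MvPolynomial.X i) ^ n ∈ V := by
  classical
  have hXL := fun i ↦ algebraMap_X_ne_zero (k := k) (L := L) (i : σ)
  have hXK : ∀ i : σ, algebraMap (MvPolynomial σ k) K (MvPolynomial.X i) ≠ 0 := fun i ↦ by
    rw [IsScalarTower.algebraMap_apply _ L K]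
    exact (map_ne_zero _).mpr (hXL i)
  have hinj : Function.Injective (algebraMap (MvPolynomial σ k) K) := by
    rw [IsScalarTower.algebraMap_eq _ L K]
    exact (algebraMap L K).injective.comp (IsFractionRing.injective _ L)
  have : CharZero L := by
    have : CharZero (MvPolynomial σ k) := charZero_of_injective_algebraMap
      (FaithfulSMul.algebraMap_injective k (MvPolynomial σ k))
    exact charZero_of_injective_algebraMap (IsFractionRing.injective (MvPolynomial σ k) L)
  have i₀ : σ := Classical.arbitrary σ
  obtain ⟨s, b, hb⟩ := FiniteDimensional.exists_is_basis_integral (MvPolynomial σ k) L K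
  have hbound : ∀ y : K, IsIntegral (MvPolynomial σ k) y → ∃ M, ∀ m, M ≤ m → ∀ i V,
      IsChart k (fun i : σ ↦ algebraMap (MvPolynomial σ k) K (MvPolynomial.X i)) i V →
      y / algebraMap (MvPolynomial σ k) K (MvPolynomial.X i) ^ m ∈ V := fun y hy ↦
    exists_forall_div_pow_mem_of_isIntegral hXK (isIntegral_adjoin_of_isIntegral hy)
  choose M hM using fun l ↦ hbound (b l) (hb l)
  let N := Finset.univ.sup M
  let t : s → σ → ℕ → L := fun l i n ↦ Algebra.trace L K (G i (n + N) * b l)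
  have ht : ∀ l i n, IsLaurentAt k i (t l i n) := by
    intro l i n
    obtain ⟨m, hm⟩ := hG i (n + N)
    refine isLaurentAt_trace_of_isIntegral (m := m) ?_
    rw [← mul_assoc]
    exact hm.mul (hb l)
  have hdiff : ∀ l i j n n', n ≤ n' → (t l i n - t l j n') *
      algebraMap _ L (MvPolynomial.X i₀ : MvPolynomial σ k) ^ n ∈ degreeValuationSubring σ k L := by
    intro l i j n n' hn
    have h1 : (t l i n - t l j n') * algebraMap _ L (MvPolynomial.X i₀ : MvPolynomial σ k) ^ n =
        Algebra.trace L K ((G i (n + N) - G j (n' + N)) *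
          algebraMap (MvPolynomial σ k) K (MvPolynomial.X i₀) ^ (n + N) *
          (b l / algebraMap (MvPolynomial σ k) K (MvPolynomial.X i₀) ^ N)) := by
      rw [← map_sub, mul_comm, ← smul_eq_mul, ← map_smul, Algebra.smul_def, map_pow,
        ← IsScalarTower.algebraMap_apply]
      congr 1
      have := hXK i₀
      field_simp
      ring
    rw [h1]
    refine trace_mem_of_forall_mem _ fun V hV ↦ ?_
    have hVc : ∀ i, IsChart k
        (fun i : σ ↦ algebraMap (MvPolynomial σ k) K (MvPolynomial.X i)) i V := by
      refine fun i ↦ ⟨fun a ↦ ?_, ?_, fun j ↦ ?_⟩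
      · rw [IsScalarTower.algebraMap_apply k (MvPolynomial σ k) K,
          IsScalarTower.algebraMap_apply _ L K]
        refine hV _ ⟨MvPolynomial.C a, 1, one_ne_zero, by simp, by simp [MvPolynomial.algebraMap_eq]⟩
      · have := hV _ (inv_X_mem_degreeValuationSubring (k := k) i)
        rwa [map_inv₀, ← IsScalarTower.algebraMap_apply] at this
      · have := hV _ (div_X_mem_degreeValuationSubring (k := k) j i)
        rwa [map_div₀, ← IsScalarTower.algebraMap_apply, ← IsScalarTower.algebraMap_apply] at this
    exact mul_mem (hGV V hVc i j _ _ (by omega) i₀)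
      (hM l N (Finset.le_sup (Finset.mem_univ l)) i₀ V (hVc i₀))
  choose p hp using fun l ↦ exists_polynomial_forall_sub_mul_pow_mem i₀ (t l) (ht l) (hdiff l)
  obtain ⟨c, hc0, hc⟩ := exists_integral_multiples (MvPolynomial σ k) L
    (Finset.univ.image b.traceDual)
  have hc' : ∀ l, IsIntegral (MvPolynomial σ k) (c • b.traceDual l) := fun l ↦
    hc _ (Finset.mem_image_of_mem _ (Finset.mem_univ l))
  choose M' hM' using fun l ↦ hbound _ (hc' l)
  let N' := Finset.univ.sup M' + 1
  refine ⟨algebraMap _ K c, ∑ l, algebraMap (MvPolynomial σ k) L (p l) • b.traceDual l, N' + N,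
    fun h ↦ hc0 (hinj (by rw [h, map_zero])), isIntegral_algebraMap, fun i n V hV ↦ ?_⟩
  have hexp : G i (n + (N' + N)) = ∑ l, t l i (n + N') • b.traceDual l := by
    conv_lhs => rw [← b.traceDual.sum_repr (G i (n + (N' + N)))]
    simp only [t, Module.Basis.traceDual_repr_apply, Algebra.traceForm_apply, add_assoc]
  rw [hexp, ← Finset.sum_sub_distrib, Finset.mul_sum, Finset.sum_mul]
  refine sum_mem fun l _ ↦ ?_
  have h1 := (ht l i (n + N')).sub_algebraMap (p l) |>.algebraMap_mul_pow_mem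
    (hp l i (n + N') (by omega)) hV
  have h2 := hM' l N' (by have := Finset.le_sup (f := M') (Finset.mem_univ l); omega) i V hV
  convert mul_mem h1 h2 using 1
  have := hXK i
  rw [← sub_smul, Algebra.smul_def, Algebra.smul_def]
  field_simp
  ring

end Algebra

section Algebra

section

variable {k K ι : Type*} [Field k] [Field K] [Algebra k K] {x : ι → K}

lemma exists_isChart_of_not_forall_mem [Finite ι] {V : ValuationSubring K}
    (hk : ∀ c : k, algebraMap k K c ∈ V) (h : ¬ ∀ i, x i ∈ V) : ∃ i, IsChart k x i V := by
  push Not at h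
  obtain ⟨i₀, hi₀⟩ := h
  have : Nonempty ι := ⟨i₀⟩
  obtain ⟨i, hi⟩ := Finite.exists_max fun i ↦ V.valuation (x i)
  have h1 : 1 < V.valuation (x i₀) := by
    rwa [← not_le, ValuationSubring.valuation_le_one_iff]
  have h2 := h1.trans_le (hi i₀)
  refine ⟨i, hk, ?_, fun j ↦ ?_⟩
  · rw [← ValuationSubring.valuation_le_one_iff, map_inv₀]
    exact inv_le_one_of_one_le₀ h2.le
  · rw [← ValuationSubring.valuation_le_one_iff, map_div₀]
    exact div_le_one_of_le₀ (hi j) zero_le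

lemma mem_of_isIntegral_adjoin {V : ValuationSubring K} (hk : ∀ c : k, algebraMap k K c ∈ V)
    (hx : ∀ i, x i ∈ V) {y : K} (hy : IsIntegral (Algebra.adjoin k (Set.range x)) y) : y ∈ V :=
  V.mem_of_isIntegral_subalgebra
    (mem_valuationSubring_of_mem_adjoin hk (by rintro _ ⟨i, rfl⟩; exact hx i)) hy

lemma mul_pow_mem_of_isChart {V : ValuationSubring K} {i j : ι} (hV : IsChart k x i V)
    (hi : x i ≠ 0) {y : K} {n : ℕ} (hy : y * x i ^ n ∈ V) : y * x j ^ n ∈ V := by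
  convert mul_mem hy (pow_mem (hV.2.2 j) n) using 1
  rw [div_pow]
  field_simp

/-- If `w` vanishes to infinite order at all valuations satisfying `T`, then `T` cannot hold for a
valuation centered in an affine model all of whose valuations are centered in `A` or satisfy
`T`. -/
lemma IsAffineModel.forall_mem_of_forall_mul_pow_mem [CharZero k] [Finite ι]
    {A C : Subalgebra k K} (hC : IsAffineModel C) (hx0 : ∀ i, x i ≠ 0) (hxA : ∀ i, x i ∈ A)
    (hint : ∀ a ∈ A, IsIntegral (Algebra.adjoin k (Set.range x)) a)
    {T : ValuationSubring K → Prop}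
    (hT : ∀ V, (∀ b ∈ C, b ∈ V) → T V ∨ ∀ a ∈ A, a ∈ V) {w : K} (hw0 : w ≠ 0)
    (hw : ∀ V, T V → ∀ i, IsChart k x i V → ∀ n, w * x i ^ n ∈ V)
    (hwA : IsIntegral (Algebra.adjoin k (Set.range x)) w)
    {V : ValuationSubring K} (hV : ∀ b ∈ C, b ∈ V) : ∀ a ∈ A, a ∈ V := by
  have hk : ∀ V : ValuationSubring K, (∀ b ∈ C, b ∈ V) → ∀ c : k, algebraMap k K c ∈ V :=
    fun V hV c ↦ hV _ (C.algebraMap_mem c)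
  refine fun a ha ↦ mem_of_isIntegral_adjoin (hk V hV) (fun l ↦ ?_) (hint a ha)
  refine hC.mem_of_forall_mul_pow_mem hw0 (fun m V' hV' ↦ ?_) V hV
  by_cases hx : ∀ i, x i ∈ V'
  · exact mul_mem (mem_of_isIntegral_adjoin (hk V' hV') hx hwA) (pow_mem (hx l) m)
  · obtain ⟨i, hi⟩ := exists_isChart_of_not_forall_mem (hk V' hV') hx
    obtain h | h := hT V' hV'
    · exact mul_pow_mem_of_isChart hi (hx0 i) (hw V' h i hi m)
    · exact absurd (fun i ↦ h _ (hxA i)) hx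

end

/-- The algebraic form of the connectedness theorem: the valuations of `K` over `k` not centered
in an affine model `A` of dimension at least two cannot be split into two nonempty parts which are
separated by a finite cover by affine models. -/
theorem IsAffineModel.false_of_separated {σ k : Type*} [Field k] [CharZero k] [Nontrivial σ]
    [Finite σ] (L : Type*) [Field L] [Algebra (MvPolynomial σ k) L]
    [IsFractionRing (MvPolynomial σ k) L]
    {K : Type*} [Field K] [Algebra k K] [Algebra (MvPolynomial σ k) K] [Algebra L K]
    [IsScalarTower k (MvPolynomial σ k) K] [IsScalarTower (MvPolynomial σ k) L K]
    {A : Subalgebra k K} (hA : IsAffineModel A)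
    (hXA : ∀ i, algebraMap (MvPolynomial σ k) K (MvPolynomial.X i) ∈ A)
    (hint : ∀ a ∈ A, IsIntegral (MvPolynomial σ k) a)
    {T₁ T₂ : ValuationSubring K → Prop} {κ : Type*} [Finite κ] (C : κ → Subalgebra k K)
    (hC : ∀ j, IsAffineModel (C j))
    (hcov : ∀ V : ValuationSubring K, (∀ c : k, algebraMap k K c ∈ V) → ∃ j, ∀ b ∈ C j, b ∈ V)
    (hCT : ∀ j, (∀ V : ValuationSubring K, (∀ b ∈ C j, b ∈ V) → ¬ T₁ V) ∨
      (∀ V : ValuationSubring K, (∀ b ∈ C j, b ∈ V) → ¬ T₂ V))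
    (hT : ∀ V : ValuationSubring K, (∀ c : k, algebraMap k K c ∈ V) →
      T₁ V ∨ T₂ V ∨ ∀ a ∈ A, a ∈ V)
    (hT₁ : ∀ V, T₁ V → ¬ ∀ a ∈ A, a ∈ V) (hT₂ : ∀ V, T₂ V → ¬ ∀ a ∈ A, a ∈ V)
    {V₁ V₂ : ValuationSubring K} (hV₁ : ∀ c : k, algebraMap k K c ∈ V₁)
    (hV₂ : ∀ c : k, algebraMap k K c ∈ V₂) (h₁ : T₁ V₁) (h₂ : T₂ V₂) : False := by
  have : FiniteDimensional L K := hA.finiteDimensional (MvPolynomial σ k) L hint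
  set x : σ → K := fun i ↦ algebraMap (MvPolynomial σ k) K (MvPolynomial.X i) with hx
  have hx0 : ∀ i, x i ≠ 0 := fun i ↦ by
    rw [hx]
    simp only
    rw [IsScalarTower.algebraMap_apply _ L K]
    exact (map_ne_zero _).mpr (algebraMap_X_ne_zero (k := k) (L := L) i)
  have hadj : ∀ y, IsIntegral (MvPolynomial σ k) y →
      IsIntegral (Algebra.adjoin k (Set.range x)) y := fun y ↦ isIntegral_adjoin_of_isIntegral
  have hint' := fun a ha ↦ hadj a (hint a ha)
  choose S hS using fun j ↦ (hC j).1
  have hSV : ∀ j, ∀ V : ValuationSubring K, (∀ c : k, algebraMap k K c ∈ V) →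
      (∀ b ∈ S j, b ∈ V) → ∀ b ∈ C j, b ∈ V := fun j V hk hV ↦ by
    rw [← hS]
    exact mem_valuationSubring_of_mem_adjoin hk hV
  have hSC : ∀ j, ∀ b ∈ S j, b ∈ C j := fun j b hb ↦ hS j ▸ Algebra.subset_adjoin hb
  obtain ⟨q, hqA, hq0, hq⟩ := hA.exists_separating hx0 hXA hint' (T₁ := T₁) (T₂ := T₂) S
    (fun V hV ↦ (hcov V hV).imp fun j hj b hb ↦ hj b (hSC j b hb))
    (fun j ↦ (hCT j).imp (fun h V hk hV ↦ h V (hSV j V hk hV))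
      (fun h V hk hV ↦ h V (hSV j V hk hV))) hT
  choose G hGA hGV using hq
  have hunit : ∀ {V i}, IsChart k x i V → (∀ a ∈ A, a ∈ V) → ∀ n, G i n ∈ V := by
    intro V i hi hAV n
    obtain ⟨m, hm⟩ := hGA i n
    convert mul_mem (hAV _ hm) (pow_mem hi.2.1 m) using 1
    have := hx0 i
    rw [inv_pow]
    field_simp
  have hdown : ∀ {V i}, IsChart k x i V → ∀ {y : K} {n m}, m ≤ n → y * x i ^ n ∈ V →
      y * x i ^ m ∈ V := by
    intro V i hi y n m hmn hy
    obtain ⟨d, rfl⟩ := Nat.exists_eq_add_of_le hmn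
    convert mul_mem hy (pow_mem hi.2.1 d) using 1
    have := hx0 i
    rw [pow_add, inv_pow]
    field_simp
  obtain ⟨c, H, M, hc0, hc, hH⟩ := exists_forall_mul_sub_mul_pow_mem L G
    (fun i n ↦ (hGA i n).imp fun m hm ↦ hint _ hm) (by
      intro V hV i j n n' hn i₀
      have hi : ∀ {y : K}, y * x i ^ n ∈ V → y * x i₀ ^ n ∈ V :=
        mul_pow_mem_of_isChart (hV i) (hx0 i)
      have hj : ∀ {y : K}, y * x j ^ n' ∈ V → y * x i₀ ^ n ∈ V :=
        fun hy ↦ mul_pow_mem_of_isChart (hV j) (hx0 j) (hdown (hV j) hn hy)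
      obtain h | h | h := hT V (hV i).1
      · convert sub_mem (hi ((hGV i n V (hV i)).1 h)) (hj ((hGV j n' V (hV j)).1 h)) using 1
        ring
      · convert sub_mem (hi ((hGV i n V (hV i)).2 h)) (hj ((hGV j n' V (hV j)).2 h)) using 1
        ring
      · exact mul_mem (sub_mem (hunit (hV i) h n) (hunit (hV j) h n'))
          (pow_mem (h _ (hXA i₀)) n))
  obtain ⟨M', hM'⟩ := exists_forall_div_pow_mem_of_isIntegral hx0 (hadj c hc)
  obtain ⟨R, hR⟩ := exists_forall_div_pow_mem_of_isIntegral hx0 (hadj _ (hc.mul (hint q hqA)))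
  have hcmul : ∀ {V i}, IsChart k x i V → ∀ {y : K} {n}, y * x i ^ (n + M' + M) ∈ V →
      c * y * x i ^ n ∈ V := by
    intro V i hi y n hy
    convert mul_mem (hdown hi (Nat.le_add_right (n + M') M) hy) (hM' M' le_rfl i V hi) using 1
    have := hx0 i
    rw [pow_add]
    field_simp
  have hW₁ : ∀ V, T₁ V → ∀ i, IsChart k x i V → ∀ n, c * (H - q) * x i ^ n ∈ V := by
    intro V h i hi n
    convert sub_mem (hcmul hi ((hGV i (n + M' + M) V hi).1 h))
      (hdown hi (Nat.le_add_right n M') (hH i (n + M') V hi)) using 1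
    ring
  have hW₂ : ∀ V, T₂ V → ∀ i, IsChart k x i V → ∀ n, c * H * x i ^ n ∈ V := by
    intro V h i hi n
    convert sub_mem (hcmul hi ((hGV i (n + M' + M) V hi).2 h))
      (hdown hi (Nat.le_add_right n M') (hH i (n + M') V hi)) using 1
    ring
  have hW : ∀ V, (∀ a ∈ A, a ∈ V) → ∀ i, IsChart k x i V → c * H ∈ V := by
    intro V h i hi
    have hcV : c ∈ V := mem_of_isIntegral_adjoin hi.1 (fun i ↦ h _ (hXA i)) (hadj c hc)
    convert sub_mem (mul_mem hcV (hunit hi h (0 + M))) (hH i 0 V hi) using 1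
    ring
  have hcq : c * q ≠ 0 := mul_ne_zero hc0 hq0
  have hnot : ∀ V : ValuationSubring K, (∀ c : k, algebraMap k K c ∈ V) →
      (¬ ∀ a ∈ A, a ∈ V) → ∃ i, IsChart k x i V := fun V hk hV ↦
    exists_isChart_of_not_forall_mem hk fun h ↦ hV fun a ha ↦
      mem_of_isIntegral_adjoin hk h (hint' a ha)
  have hHq : H = 0 ∨ H = q := by
    by_contra! hne
    obtain ⟨i, hi⟩ := hnot V₁ hV₁ (hT₁ V₁ h₁)
    obtain ⟨B, hB, hBV, -⟩ := hA.exists_chart hx0 hXA hint' i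
    have hxi : x i ∈ V₁ := by
      refine hB.mem_of_forall_mul_pow_mem (w := (c * H) * (c * (H - q)))
        (mul_ne_zero (mul_ne_zero hc0 hne.1) (mul_ne_zero hc0 (sub_ne_zero.mpr hne.2)))
        (fun m V hV ↦ ?_) V₁ ((hBV V₁).mpr hi)
      rw [hBV] at hV
      have hq' := hR R le_rfl i V hV
      have hxi := hx0 i
      obtain h | h | h := hT V hV.1
      · have h1 := hdown hV (Nat.zero_le _) (hW₁ V h i hV 0)
        have h2 := hW₁ V h i hV (m + R)
        have h3 := add_mem (mul_mem h1 (pow_mem hV.2.1 R)) hq'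
        convert mul_mem h2 h3 using 1
        rw [pow_add, inv_pow]
        field_simp
        ring
      · have h1 := hdown hV (Nat.zero_le _) (hW₂ V h i hV 0)
        have h2 := hW₂ V h i hV (m + R)
        have h3 := sub_mem (mul_mem h1 (pow_mem hV.2.1 R)) hq'
        convert mul_mem h2 h3 using 1
        rw [pow_add, inv_pow]
        field_simp
      · have hcV : c ∈ V := mem_of_isIntegral_adjoin hV.1 (fun i ↦ h _ (hXA i)) (hadj c hc)
        have h1 := hW V h i hV
        have h2 : c * (H - q) ∈ V := by
          rw [mul_sub]
          exact sub_mem h1 (mul_mem hcV (h q hqA))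
        exact mul_mem (mul_mem h1 h2) (pow_mem (h _ (hXA i)) m)
    refine hT₁ V₁ h₁ fun a ha ↦ mem_of_isIntegral_adjoin hV₁ (fun j ↦ ?_) (hint' a ha)
    convert mul_mem hxi (hi.2.2 j) using 1
    have := hx0 i
    field_simp
  have hcqA := hadj _ (hc.mul (hint q hqA))
  obtain rfl | rfl := hHq
  · obtain ⟨j, hj⟩ := hcov V₁ hV₁
    have hj₂ := (hCT j).resolve_left fun h ↦ h V₁ hj h₁
    refine hT₁ V₁ h₁ ((hC j).forall_mem_of_forall_mul_pow_mem hx0 hXA hint' (T := T₁)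
      (fun V hV ↦ ?_) hcq (fun V h i hi n ↦ ?_) hcqA hj)
    · obtain h | h | h := hT V fun c ↦ hV _ ((C j).algebraMap_mem c)
      exacts [.inl h, absurd h (hj₂ V hV), .inr h]
    · convert neg_mem (hW₁ V h i hi n) using 1
      ring
  · obtain ⟨j, hj⟩ := hcov V₂ hV₂
    have hj₁ := (hCT j).resolve_right fun h ↦ h V₂ hj h₂
    refine hT₂ V₂ h₂ ((hC j).forall_mem_of_forall_mul_pow_mem hx0 hXA hint' (T := T₂)
      (fun V hV ↦ ?_) hcq hW₂ hcqA hj)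
    obtain h | h | h := hT V fun c ↦ hV _ ((C j).algebraMap_mem c)
    exacts [absurd h (hj₁ V hV), .inl h, .inr h]

end Algebra

section Algebra

lemma ringKrullDim_le_of_isIntegral (R S : Type*) [CommRing R] [CommRing S] [Algebra R S]
    [Algebra.IsIntegral R S] : ringKrullDim S ≤ ringKrullDim R :=
  Order.krullDim_le_of_strictMono (PrimeSpectrum.comap (algebraMap R S)) fun _ _ h ↦
    Ideal.IsIntegral.comap_lt_comap h

variable {k K : Type*} [Field k] [Field K] [Algebra k K]

theorem IsAffineModel.false_of_separated_of_two_le [CharZero k] {A : Subalgebra k K}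
    (hA : IsAffineModel A) (hdim : 2 ≤ ringKrullDim A)
    {T₁ T₂ : ValuationSubring K → Prop} {κ : Type*} [Finite κ] (C : κ → Subalgebra k K)
    (hC : ∀ j, IsAffineModel (C j))
    (hcov : ∀ V : ValuationSubring K, (∀ c : k, algebraMap k K c ∈ V) → ∃ j, ∀ b ∈ C j, b ∈ V)
    (hCT : ∀ j, (∀ V : ValuationSubring K, (∀ b ∈ C j, b ∈ V) → ¬ T₁ V) ∨
      (∀ V : ValuationSubring K, (∀ b ∈ C j, b ∈ V) → ¬ T₂ V))
    (hT : ∀ V : ValuationSubring K, (∀ c : k, algebraMap k K c ∈ V) →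
      T₁ V ∨ T₂ V ∨ ∀ a ∈ A, a ∈ V)
    (hT₁ : ∀ V, T₁ V → ¬ ∀ a ∈ A, a ∈ V) (hT₂ : ∀ V, T₂ V → ¬ ∀ a ∈ A, a ∈ V)
    {V₁ V₂ : ValuationSubring K} (hV₁ : ∀ c : k, algebraMap k K c ∈ V₁)
    (hV₂ : ∀ c : k, algebraMap k K c ∈ V₂) (h₁ : T₁ V₁) (h₂ : T₂ V₂) : False := by
  have hft : Algebra.FiniteType k A := (Subalgebra.fg_iff_finiteType A).mp hA.1
  obtain ⟨s, g, hg, hgf⟩ := exists_integral_inj_algHom_of_fg k A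
  let P := MvPolynomial (Fin s) k
  let φ : P →ₐ[k] K := A.val.comp g
  have hφ : Function.Injective φ := Subtype.val_injective.comp hg
  let : Algebra P A := g.toRingHom.toAlgebra
  let : Algebra P K := φ.toRingHom.toAlgebra
  have : IsScalarTower P A K := IsScalarTower.of_algebraMap_eq' rfl
  have : IsScalarTower k P K := IsScalarTower.of_algebraMap_eq' φ.comp_algebraMap.symm
  have : FaithfulSMul P K := (faithfulSMul_iff_algebraMap_injective P K).mpr hφ
  have : Algebra.IsIntegral P A := ⟨hgf⟩
  let L := FractionRing P
  let : Algebra L K := FractionRing.liftAlgebra P K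
  have : IsScalarTower P L K := FractionRing.isScalarTower_liftAlgebra P K
  have hAP : ∀ a ∈ A, IsIntegral P a := fun a ha ↦
    (Algebra.IsIntegral.isIntegral (R := P) (⟨a, ha⟩ : A)).map (IsScalarTower.toAlgHom P A K)
  have hs : 2 ≤ s := by
    have h := hdim.trans (ringKrullDim_le_of_isIntegral P A)
    rw [MvPolynomial.ringKrullDim_of_isNoetherianRing, ringKrullDim_eq_zero_of_field, zero_add]
      at h
    simpa using h
  have : Nontrivial (Fin s) := Fin.nontrivial_iff_two_le.mpr hs
  exact hA.false_of_separated L (fun i ↦ (g (MvPolynomial.X i)).2) hAP C hC hcov hCT hT hT₁ hT₂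
    hV₁ hV₂ h₁ h₂

end Algebra

section Centers

universe u

namespace AlgebraicGeometry

lemma Scheme.isSeparated_of_hom {X S : Scheme.{u}} [S.IsSeparated] (f : X ⟶ S) [IsSeparated f] :
    X.IsSeparated :=
  ⟨by
    rw [← Limits.terminal.comp_from f]
    infer_instance⟩

lemma isDominant_SpecMap_of_injective {R S : CommRingCat.{u}} (φ : R ⟶ S)
    (hφ : Function.Injective φ.hom) : IsDominant (Spec.map φ) where
  denseRange := by
    have h := (PrimeSpectrum.denseRange_comap_iff_ker_le_nilRadical φ.hom).mpr
      (by rw [(RingHom.injective_iff_ker_eq_bot _).mp hφ]; exact bot_le)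
    exact h

variable {X : Scheme.{u}} [IsIntegral X]

/-- The regular functions on a nonempty open subset, as a subring of the function field. -/
noncomputable def Scheme.sectionsRange (X : Scheme.{u}) [IsIntegral X] (U : X.Opens) [Nonempty U] :
    Subring X.functionField :=
  (X.germToFunctionField U).hom.range

/-- `z` is the center of the valuation ring `V` on the separated scheme `X`. -/
def Scheme.IsCenter (V : ValuationSubring X.functionField) (z : X) : Prop :=
  ∀ (U : X.Opens) [Nonempty U], IsAffineOpen U → (z ∈ U ↔ X.sectionsRange U ≤ V.toSubring)

lemma isCenter_closedPoint [X.IsSeparated] (V : ValuationSubring X.functionField)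
    (l : Spec (CommRingCat.of V) ⟶ X)
    (hl : Spec.map (CommRingCat.ofHom (algebraMap V X.functionField)) ≫ l =
      X.fromSpecStalk (genericPoint X)) :
    Scheme.IsCenter V (l (IsLocalRing.closedPoint V)) := by
  intro U _ hU
  constructor
  · rintro hz _ ⟨s, rfl⟩
    have h1 := Scheme.Spec_stalkClosedPointTo_fromSpecStalk l
    have hsp : genericPoint X ⤳ l (IsLocalRing.closedPoint (CommRingCat.of V)) :=
      genericPoint_specializes _
    have h2 : Scheme.stalkClosedPointTo l ≫
        CommRingCat.ofHom (algebraMap V X.functionField) = X.presheaf.stalkSpecializes hsp := by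
      apply Spec.map_injective
      rw [← cancel_mono (X.fromSpecStalk _), Spec.map_comp, Category.assoc, h1,
        Scheme.SpecMap_stalkSpecializes_fromSpecStalk, hl]
    have h3 : X.germToFunctionField U = X.presheaf.germ U _ hz ≫ Scheme.stalkClosedPointTo l ≫
        CommRingCat.ofHom (algebraMap V X.functionField) := by
      rw [h2, TopCat.Presheaf.germ_stalkSpecializes]
    rw [h3]
    exact ((X.presheaf.germ U _ hz ≫ Scheme.stalkClosedPointTo l).hom s).2
  · intro hV
    let φ : Γ(X, U) ⟶ CommRingCat.of V := CommRingCat.ofHom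
      ((X.germToFunctionField U).hom.codRestrict V.toSubring fun s ↦ hV ⟨s, rfl⟩)
    have hφ : φ ≫ CommRingCat.ofHom (algebraMap V X.functionField) = X.germToFunctionField U := rfl
    have hd : IsDominant (Spec.map (CommRingCat.ofHom (algebraMap V X.functionField))) :=
      isDominant_SpecMap_of_injective _ Subtype.val_injective
    have h : l = Spec.map φ ≫ hU.fromSpec := by
      refine ext_of_isDominant (Spec.map (CommRingCat.ofHom (algebraMap V X.functionField))) ?_
      rw [hl, ← Spec.map_comp_assoc, hφ, ← hU.fromSpecStalk_eq_fromSpecStalk,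
        IsAffineOpen.fromSpecStalk]
    rw [h]
    exact hU.range_fromSpec.le ⟨Spec.map φ (IsLocalRing.closedPoint V),
      (Scheme.Hom.comp_apply _ _ _).symm⟩

lemma exists_isCenter_of_point [X.IsSeparated] (z : X) :
    ∃ V : ValuationSubring X.functionField, Scheme.IsCenter V z := by
  have hsp : genericPoint X ⤳ z := genericPoint_specializes _
  obtain ⟨V, hV, hloc⟩ := IsLocalRing.exists_factor_valuationRing
    (X.presheaf.stalkSpecializes hsp).hom
  let φ : X.presheaf.stalk z ⟶ CommRingCat.of V :=
    CommRingCat.ofHom ((X.presheaf.stalkSpecializes hsp).hom.codRestrict V.toSubring hV)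
  have hφ : φ ≫ CommRingCat.ofHom (algebraMap V X.functionField) =
    X.presheaf.stalkSpecializes hsp := rfl
  have hcl : Spec.map φ (IsLocalRing.closedPoint V) = IsLocalRing.closedPoint _ :=
    IsLocalRing.comap_closedPoint _
  refine ⟨V, ?_⟩
  have h := isCenter_closedPoint V (Spec.map φ ≫ X.fromSpecStalk z) (by
    rw [← Spec.map_comp_assoc, hφ, Scheme.SpecMap_stalkSpecializes_fromSpecStalk])
  have hz : (Spec.map φ ≫ X.fromSpecStalk z) (IsLocalRing.closedPoint V) = z :=
    (Scheme.Hom.comp_apply _ _ _).trans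
      ((congrArg _ hcl).trans Scheme.fromSpecStalk_closedPoint)
  rwa [hz] at h

end AlgebraicGeometry

end Centers

section Connectedness

universe u

namespace AlgebraicGeometry

variable {k : Type u} [Field k] {X : Scheme.{u}} [IsIntegral X]

/-- The embedding of the base field into the function field. -/
noncomputable def Scheme.Hom.toFunctionField (f : X ⟶ Spec (CommRingCat.of k)) :
    CommRingCat.of k ⟶ X.functionField :=
  (Scheme.ΓSpecIso _).inv ≫ f.appTop ≫ X.presheaf.germ ⊤ _ trivial

lemma fromSpecStalk_comp_eq_SpecMap_toFunctionField (f : X ⟶ Spec (CommRingCat.of k)) :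
    X.fromSpecStalk (genericPoint X) ≫ f = Spec.map f.toFunctionField := by
  have h : f = X.toSpecΓ ≫ Spec.map ((Scheme.ΓSpecIso _).inv ≫ f.appTop) := by
    rw [Spec.map_comp, ← Scheme.toSpecΓ_naturality_assoc, ← SpecMap_ΓSpecIso_hom,
      ← Spec.map_comp, Iso.inv_hom_id, Spec.map_id, Category.comp_id]
  conv_lhs => rw [h]
  rw [← Category.assoc, Scheme.fromSpecStalk_toSpecΓ, ← Spec.map_comp]
  simp [Scheme.Hom.toFunctionField]

variable [Algebra k X.functionField]

lemma exists_isCenter (f : X ⟶ Spec (CommRingCat.of k)) [IsProper f] [X.IsSeparated]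
    (hf : algebraMap k X.functionField = f.toFunctionField.hom)
    {V : ValuationSubring X.functionField} (hV : ∀ c : k, algebraMap k X.functionField c ∈ V) :
    ∃ z : X, Scheme.IsCenter V z := by
  let φ : CommRingCat.of k ⟶ CommRingCat.of V := CommRingCat.ofHom
    ((algebraMap k X.functionField).codRestrict V.toSubring hV)
  have hφ : φ ≫ CommRingCat.ofHom (algebraMap V X.functionField) = f.toFunctionField := by
    ext c
    exact DFunLike.congr_fun hf c
  have hex : ValuativeCriterion.Existence f := by
    have h : UniversallyClosed f := inferInstance
    rw [UniversallyClosed.eq_valuativeCriterion] at h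
    exact h.1
  let S : ValuativeCommSq f :=
    { R := V
      K := X.functionField
      i₁ := X.fromSpecStalk (genericPoint X)
      i₂ := Spec.map φ
      commSq := ⟨by
        rw [← Spec.map_comp, hφ, fromSpecStalk_comp_eq_SpecMap_toFunctionField]⟩ }
  obtain ⟨⟨l⟩⟩ := hex S
  exact ⟨_, isCenter_closedPoint V l.l l.fac_left⟩

lemma exists_isAffineModel (f : X ⟶ Spec (CommRingCat.of k)) [LocallyOfFiniteType f]
    (hf : algebraMap k X.functionField = f.toFunctionField.hom)
    {U : X.Opens} [Nonempty U] (hU : IsAffineOpen U) :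
    ∃ C : Subalgebra k X.functionField, IsAffineModel C ∧ C.toSubring = X.sectionsRange U ∧
      Nonempty (Γ(X, U) ≃+* C) := by
  let ψ : CommRingCat.of k ⟶ Γ(X, U) := (Scheme.ΓSpecIso _).inv ≫ f.appLE ⊤ U le_top
  have hψ : ψ ≫ X.germToFunctionField U = f.toFunctionField := by
    simp only [ψ, Scheme.Hom.toFunctionField, Scheme.Hom.appLE, Scheme.germToFunctionField,
      Category.assoc, TopCat.Presheaf.germ_res]
    rfl
  have hft : ψ.hom.FiniteType := by
    refine (f.finiteType_appLE (isAffineOpen_top _) hU le_top).comp ?_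
    exact .of_surjective _
      (Scheme.ΓSpecIso (CommRingCat.of k)).symm.commRingCatIsoToRingEquiv.surjective
  let : Algebra k Γ(X, U) := ψ.hom.toAlgebra
  have : Algebra.FiniteType k Γ(X, U) := hft
  let g : Γ(X, U) →ₐ[k] X.functionField :=
    { (X.germToFunctionField U).hom with
      commutes' := fun c ↦ by
        rw [hf, ← hψ]
        rfl }
  have hg : Function.Injective g := X.germToFunctionField_injective U
  have := functionField_isFractionRing_of_isAffineOpen X U hU
  refine ⟨g.range, ⟨?_, fun y ↦ ?_⟩, ?_, ⟨(AlgEquiv.ofInjective g hg).toRingEquiv⟩⟩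
  · rw [Subalgebra.fg_iff_finiteType]
    exact .of_surjective g.rangeRestrict g.rangeRestrict_surjective
  · obtain ⟨a, b, hb, rfl⟩ := IsFractionRing.div_surjective (A := Γ(X, U)) y
    exact ⟨_, ⟨a, rfl⟩, _, ⟨b, rfl⟩, (map_ne_zero_iff g hg).mpr (nonZeroDivisors.ne_zero hb), rfl⟩
  · rfl

end AlgebraicGeometry

end Connectedness

section Connectedness

universe u

namespace AlgebraicGeometry

variable {k : Type u} [Field k] [CharZero k] {X : Scheme.{u}} [IsIntegral X]

/-- The complement of an affine open of dimension at least two in an integral proper scheme over a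
field of characteristic zero is connected. -/
theorem IsAffineOpen.isConnected_compl (f : X ⟶ Spec (CommRingCat.of k)) [IsProper f]
    {U : X.Opens} (hU : IsAffineOpen U) (hdim : 2 ≤ ringKrullDim Γ(X, U)) :
    IsConnected (U : Set X)ᶜ := by
  have hX : X.IsSeparated := Scheme.isSeparated_of_hom f
  have hcpt : CompactSpace X := QuasiCompact.compactSpace_of_compactSpace f
  have hUne : Nonempty U := by
    by_contra hne
    have hbot : U = ⊥ := by
      ext z
      exact ⟨fun hz ↦ (hne ⟨⟨z, hz⟩⟩).elim, fun hz ↦ hz.elim⟩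
    have : Subsingleton Γ(X, U) := by
      rw [hbot]
      infer_instance
    rw [ringKrullDim_eq_bot_of_subsingleton] at hdim
    simp at hdim
  let : Algebra k X.functionField := f.toFunctionField.hom.toAlgebra
  have hf : algebraMap k X.functionField = f.toFunctionField.hom := rfl
  obtain ⟨A, hA, hAU, ⟨eA⟩⟩ := exists_isAffineModel f hf hU
  have hdimA : 2 ≤ ringKrullDim A := by rwa [← ringKrullDim_eq_of_ringEquiv eA]
  have hAV : ∀ V : ValuationSubring X.functionField,
      X.sectionsRange U ≤ V.toSubring ↔ ∀ a ∈ A, a ∈ V := fun V ↦ by rw [← hAU]; rfl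
  refine ⟨?_, ?_⟩
  · by_contra hne
    rw [Set.not_nonempty_iff_eq_empty, Set.compl_empty_iff] at hne
    have hint : Algebra.IsIntegral k A := by
      refine ⟨fun a ↦ ?_⟩
      have ha : _root_.IsIntegral (⊥ : Subalgebra k X.functionField) (a : X.functionField) := by
        refine isIntegral_of_forall_mem_valuationSubring _ fun V hV ↦ ?_
        obtain ⟨z, hz⟩ := exists_isCenter f hf fun c ↦ hV _ (Subalgebra.algebraMap_mem ⊥ c)
        have hzU : z ∈ (U : Set X) := hne ▸ Set.mem_univ z
        exact (hAV V).mp ((hz U hU).mp hzU) a a.2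
      have : Algebra.IsIntegral k (⊥ : Subalgebra k X.functionField) := by
        refine ⟨fun b ↦ ?_⟩
        obtain ⟨c, hc⟩ := Algebra.mem_bot.mp b.2
        have hcb : algebraMap k (⊥ : Subalgebra k X.functionField) c = b := Subtype.ext hc
        exact hcb ▸ isIntegral_algebraMap
      exact (isIntegral_algHom_iff A.val Subtype.val_injective).mp (isIntegral_trans _ ha)
    have h := hdimA.trans (ringKrullDim_le_of_isIntegral k A)
    rw [ringKrullDim_eq_zero_of_field] at h
    exact absurd h (by decide)
  · rw [isPreconnected_closed_iff]
    intro Z₁ Z₂ hZ₁ hZ₂ hcov hne₁ hne₂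
    by_contra hemp
    obtain ⟨z₁, hz₁U, hz₁⟩ := hne₁
    obtain ⟨z₂, hz₂U, hz₂⟩ := hne₂
    have hloc : ∀ z : X, ∃ W : X.Opens, IsAffineOpen W ∧ z ∈ W ∧
        ((∀ y ∈ W, y ∉ U → y ∉ Z₁) ∨ (∀ y ∈ W, y ∉ U → y ∉ Z₂)) := by
      intro z
      have key : ∀ Z : Set X, IsClosed Z → (z ∈ U ∨ z ∉ Z) → ∃ W : X.Opens, IsAffineOpen W ∧
          z ∈ W ∧ ∀ y ∈ W, y ∉ U → y ∉ Z := by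
        intro Z hZ hz
        obtain ⟨_, ⟨W, hW, rfl⟩, hzW, hWZ⟩ := X.isBasis_affineOpens.exists_subset_of_mem_open
          (show z ∈ (U : Set X) ∪ Zᶜ from hz) (U.isOpen.union hZ.isOpen_compl)
        exact ⟨W, hW, hzW, fun y hy hyU ↦ (hWZ hy).resolve_left hyU⟩
      by_cases hz : z ∈ U ∨ z ∉ Z₁
      · obtain ⟨W, hW, hzW, h⟩ := key Z₁ hZ₁ hz
        exact ⟨W, hW, hzW, .inl h⟩
      · push Not at hz
        obtain ⟨W, hW, hzW, h⟩ := key Z₂ hZ₂ (.inr fun hz' ↦ hemp ⟨z, hz.1, hz.2, hz'⟩)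
        exact ⟨W, hW, hzW, .inr h⟩
    choose W hW hzW hWZ using hloc
    have hWne : ∀ z, Nonempty (W z) := fun z ↦ ⟨⟨z, hzW z⟩⟩
    obtain ⟨t, ht⟩ := isCompact_univ.elim_finite_subcover (fun z ↦ (W z : Set X))
      (fun z ↦ (W z).isOpen) fun z _ ↦ Set.mem_iUnion.mpr ⟨z, hzW z⟩
    choose C hC hCW using fun z ↦ exists_isAffineModel f hf (hW z)
    have hCV : ∀ z, ∀ V : ValuationSubring X.functionField,
        X.sectionsRange (W z) ≤ V.toSubring ↔ ∀ a ∈ C z, a ∈ V := fun z V ↦ by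
      rw [← (hCW z).1]; rfl
    have hk : ∀ z (V : ValuationSubring X.functionField), Scheme.IsCenter V z →
        ∀ c : k, algebraMap k X.functionField c ∈ V := fun z V hV c ↦
      (hCV z V).mp ((hV (W z) (hW z)).mp (hzW z)) _ ((C z).algebraMap_mem c)
    obtain ⟨V₁, hV₁⟩ := exists_isCenter_of_point z₁
    obtain ⟨V₂, hV₂⟩ := exists_isCenter_of_point z₂
    refine hA.false_of_separated_of_two_le hdimA
      (T₁ := fun V ↦ ∃ z ∈ Z₁, z ∉ U ∧ Scheme.IsCenter V z)
      (T₂ := fun V ↦ ∃ z ∈ Z₂, z ∉ U ∧ Scheme.IsCenter V z) (fun z : t ↦ C z.1)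
      (fun z ↦ hC z.1) (fun V hV ↦ ?_) (fun z ↦ (hWZ z).imp ?_ ?_) (fun V hV ↦ ?_) ?_ ?_
      (hk z₁ V₁ hV₁) (hk z₂ V₂ hV₂) ⟨z₁, hz₁, hz₁U, hV₁⟩ ⟨z₂, hz₂, hz₂U, hV₂⟩
    · obtain ⟨z, hz⟩ := exists_isCenter f hf hV
      obtain ⟨w, hw, hzw⟩ := Set.mem_iUnion₂.mp (ht (Set.mem_univ z))
      exact ⟨⟨w, hw⟩, (hCV w V).mp ((hz (W w) (hW w)).mp hzw)⟩
    · rintro h V hV ⟨y, hy, hyU, hyV⟩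
      exact h y ((hyV (W z) (hW z)).mpr ((hCV z V).mpr hV)) hyU hy
    · rintro h V hV ⟨y, hy, hyU, hyV⟩
      exact h y ((hyV (W z) (hW z)).mpr ((hCV z V).mpr hV)) hyU hy
    · obtain ⟨z, hz⟩ := exists_isCenter f hf hV
      by_cases hzU : z ∈ U
      · exact .inr (.inr ((hAV V).mp ((hz U hU).mp hzU)))
      · obtain h | h := hcov hzU
        exacts [.inl ⟨z, h, hzU, hz⟩, .inr (.inl ⟨z, h, hzU, hz⟩)]
    · rintro V ⟨z, -, hzU, hz⟩ h
      exact hzU ((hz U hU).mpr ((hAV V).mpr h))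
    · rintro V ⟨z, -, hzU, hz⟩ h
      exact hzU ((hz U hU).mpr ((hAV V).mpr h))

end AlgebraicGeometry

end Connectedness

/-- Let `X` be an affine variety over `ℂ` and `Y ⊆ X` a closed subvariety. If `Xbar` is an
irreducible complete variety containing `Y` as an open subset and `dim Y ≥ 2`, then
`Xbar \ Y` is connected. -/
theorem complement_connected_of_closed_subvariety_of_affine
    (X Y Xbar : Scheme) [IsAffine X] [IsIntegral X] [IsIntegral Y] [IsIntegral Xbar]
    (fX : X ⟶ Spec (CommRingCat.of ℂ)) [LocallyOfFiniteType fX]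
    (i : Y ⟶ X) [IsClosedImmersion i]
    (fbar : Xbar ⟶ Spec (CommRingCat.of ℂ)) [IsProper fbar]
    (j : Y ⟶ Xbar) [IsOpenImmersion j]
    (hdim : 2 ≤ topologicalKrullDim Y) :
    IsConnected ((Set.range j.base)ᶜ) := by
  have hY : IsAffine Y := isAffine_of_isAffineHom i
  have hU : IsAffineOpen (j ''ᵁ ⊤) := (isAffineOpen_top Y).image_of_isOpenImmersion j
  have h := hU.isConnected_compl fbar (by
    rw [ringKrullDim_eq_of_ringEquiv (j.appIso ⊤).commRingCatIsoToRingEquiv,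
      ← PrimeSpectrum.topologicalKrullDim_eq_ringKrullDim]
    rwa [IsHomeomorph.topologicalKrullDim_eq _
      (Scheme.homeoOfIso Y.isoSpec).isHomeomorph] at hdim)
  rwa [Scheme.Hom.coe_image, TopologicalSpace.Opens.coe_top, Set.image_univ] at h
end
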